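/- For a hermitian d×d matrix-valued free polynomial p(x,y) in the freely noncommuting variables x_1,…,x_μ, y_1,…,y_μ, the following are equivalent: (i) p is xy-convex; (ii) p is convex in x and convex in y separately; (iii) there exist a hermitian d×d matrix-valued xy-pencil λ, a positive integer N and an N×d matrix-valued xy-pencil Λ such that p(x,y) = λ(x,y) + Λ(x,y)* Λ(x,y). -/

import Mathlib

open Matrix ComplexOrder

abbrev FreeWord (μ : ℕ) := FreeMonoid (Fin μ ⊕ Fin μ)

abbrev NCPoly (N d μ : ℕ) := FreeWord μ →₀ Matrix (Fin N) (Fin d) ℂ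

noncomputable def wordEval {μ : ℕ} {k : Type*} [Fintype k] [DecidableEq k]
    (X Y : Fin μ → Matrix k k ℂ) (w : FreeWord μ) : Matrix k k ℂ :=
  (w.toList.map (Sum.elim X Y)).prod

noncomputable def polyEval {N d μ : ℕ} {k : Type*} [Fintype k] [DecidableEq k]
    (p : NCPoly N d μ) (X Y : Fin μ → Matrix k k ℂ) :
    Matrix (Fin N × k) (Fin d × k) ℂ :=
  p.sum fun w c => Matrix.kroneckerMap (· * ·) c (wordEval X Y w)

noncomputable def polyStar {N d μ : ℕ} (p : NCPoly N d μ) : NCPoly d N μ :=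
  Finsupp.mapDomain (fun w => FreeMonoid.ofList w.toList.reverse)
    (Finsupp.mapRange Matrix.conjTranspose (by simp) p)

noncomputable def polyMul {a b c μ : ℕ} (p : FreeWord μ →₀ Matrix (Fin a) (Fin b) ℂ)
    (q : FreeWord μ →₀ Matrix (Fin b) (Fin c) ℂ) :
    FreeWord μ →₀ Matrix (Fin a) (Fin c) ℂ :=
  p.sum fun u cu => q.sum fun v cv => Finsupp.single (u * v) (cu * cv)

def loewnerLE {k : Type*} [Fintype k] (A B : Matrix k k ℂ) : Prop := (B - A).PosSemidef

noncomputable def kronId {k l : Type*} (d : ℕ) (V : Matrix k l ℂ) :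
    Matrix (Fin d × k) (Fin d × l) ℂ :=
  Matrix.kroneckerMap (· * ·) (1 : Matrix (Fin d) (Fin d) ℂ) V

noncomputable def compress {μ : ℕ} {k l : Type*} [Fintype k] (V : Matrix k l ℂ)
    (X : Fin μ → Matrix k k ℂ) : Fin μ → Matrix l l ℂ :=
  fun i => Vᴴ * X i * V

def degX {μ : ℕ} (w : FreeWord μ) : ℕ := (w.toList.filter Sum.isLeft).length

def degY {μ : ℕ} (w : FreeWord μ) : ℕ := (w.toList.filter Sum.isRight).length

def IsXYPencil {N d μ : ℕ} (Λ : NCPoly N d μ) : Prop :=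
  ∀ w : FreeWord μ, Λ w ≠ 0 → degX w ≤ 1 ∧ degY w ≤ 1

def IsXYConvex {d μ : ℕ} (p : NCPoly d d μ) : Prop :=
  ∀ (n m : ℕ) (X Y : Fin μ → Matrix (Fin n) (Fin n) ℂ),
    (∀ i, (X i).IsHermitian) → (∀ i, (Y i).IsHermitian) →
    ∀ V : Matrix (Fin n) (Fin m) ℂ, Vᴴ * V = 1 →
    (∀ i j, Vᴴ * (X i * Y j) * V = (Vᴴ * X i * V) * (Vᴴ * Y j * V)) →
    loewnerLE (polyEval p (compress V X) (compress V Y))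
      ((kronId d V)ᴴ * polyEval p X Y * kronId d V)

/-- `p(x,y)` is convex in `x`: for all hermitian tuples `X¹, X², Y` of every size and all
`t ∈ [0,1]`, `p(tX¹+(1-t)X², Y) ⪯ t p(X¹,Y) + (1-t) p(X²,Y)`. -/
def IsConvexInX {d μ : ℕ} (p : NCPoly d d μ) : Prop :=
  ∀ (n : ℕ) (X₁ X₂ Y : Fin μ → Matrix (Fin n) (Fin n) ℂ),
    (∀ i, (X₁ i).IsHermitian) → (∀ i, (X₂ i).IsHermitian) → (∀ i, (Y i).IsHermitian) →
    ∀ t : ℝ, 0 ≤ t → t ≤ 1 →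
    loewnerLE (polyEval p (fun i => t • X₁ i + (1 - t) • X₂ i) Y)
      (t • polyEval p X₁ Y + (1 - t) • polyEval p X₂ Y)

/-- `p(x,y)` is convex in `y`. -/
def IsConvexInY {d μ : ℕ} (p : NCPoly d d μ) : Prop :=
  ∀ (n : ℕ) (X Y₁ Y₂ : Fin μ → Matrix (Fin n) (Fin n) ℂ),
    (∀ i, (X i).IsHermitian) → (∀ i, (Y₁ i).IsHermitian) → (∀ i, (Y₂ i).IsHermitian) →
    ∀ t : ℝ, 0 ≤ t → t ≤ 1 →
    loewnerLE (polyEval p X (fun i => t • Y₁ i + (1 - t) • Y₂ i))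
      (t • polyEval p X Y₁ + (1 - t) • polyEval p X Y₂)


section Evaluation

variable {N d μ : ℕ} {k l : Type*} [Fintype k] [DecidableEq k] [Fintype l] [DecidableEq l]

lemma wordEval_ofList (X Y : Fin μ → Matrix k k ℂ) (w : List (Fin μ ⊕ Fin μ)) :
    wordEval X Y (FreeMonoid.ofList w) = (w.map (Sum.elim X Y)).prod := rfl

lemma wordEval_mul (X Y : Fin μ → Matrix k k ℂ) (u v : FreeWord μ) :
    wordEval X Y (u * v) = wordEval X Y u * wordEval X Y v := by
  simp [wordEval]

lemma prod_map_reverse_eq_conjTranspose {α : Type*} (Z : α → Matrix k k ℂ)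
    (hZ : ∀ z, (Z z).IsHermitian) (w : List α) :
    (w.reverse.map Z).prod = ((w.map Z).prod)ᴴ := by
  induction w with
  | nil => simp
  | cons z w ih =>
    rw [List.reverse_cons, List.map_append, List.prod_append, ih, List.map_cons (l := w),
      List.prod_cons (l := w.map Z), Matrix.conjTranspose_mul, (hZ z).eq]
    simp

omit [Fintype k] [DecidableEq k] in
lemma sumElim_isHermitian {X Y : Fin μ → Matrix k k ℂ} (hX : ∀ i, (X i).IsHermitian)
    (hY : ∀ i, (Y i).IsHermitian) (z : Fin μ ⊕ Fin μ) : (Sum.elim X Y z).IsHermitian := by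
  rcases z with i | i
  · exact hX i
  · exact hY i

lemma prod_map_submatrix {α : Type*} (Z : α → Matrix k k ℂ) (e : l ≃ k) (w : List α) :
    (w.map fun z => (Z z).submatrix e e).prod = ((w.map Z).prod).submatrix e e := by
  induction w with
  | nil => simp
  | cons z w ih => simp [ih, Matrix.submatrix_mul_equiv]

lemma wordEval_submatrix (X Y : Fin μ → Matrix k k ℂ) (e : l ≃ k) (w : FreeWord μ) :
    wordEval (fun i => (X i).submatrix e e) (fun i => (Y i).submatrix e e) w =
      (wordEval X Y w).submatrix e e := by
  rw [wordEval, wordEval, ← prod_map_submatrix]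
  congr 2
  funext z
  rcases z with i | i <;> rfl

lemma polyEval_apply (p : NCPoly N d μ) (X Y : Fin μ → Matrix k k ℂ) (i : Fin N × k)
    (j : Fin d × k) :
    polyEval p X Y i j = p.sum fun w c => c i.1 j.1 * wordEval X Y w i.2 j.2 := by
  simp [polyEval, Finsupp.sum, Matrix.sum_apply]

lemma polyEval_submatrix (p : NCPoly N d μ) (X Y : Fin μ → Matrix k k ℂ) (e : l ≃ k) :
    polyEval p (fun i => (X i).submatrix e e) (fun i => (Y i).submatrix e e) =
      (polyEval p X Y).submatrix (Prod.map id e) (Prod.map id e) := by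
  ext i j
  simp [polyEval_apply, wordEval_submatrix]

lemma polyEval_add (p q : NCPoly N d μ) (X Y : Fin μ → Matrix k k ℂ) :
    polyEval (p + q) X Y = polyEval p X Y + polyEval q X Y := by
  unfold polyEval
  apply Finsupp.sum_add_index'
  · intro w; ext; simp
  · intro w a b; ext; simp [add_mul]

lemma polyEval_single (w : FreeWord μ) (c : Matrix (Fin N) (Fin d) ℂ)
    (X Y : Fin μ → Matrix k k ℂ) :
    polyEval (Finsupp.single w c) X Y = Matrix.kroneckerMap (· * ·) c (wordEval X Y w) := by
  unfold polyEval
  apply Finsupp.sum_single_index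
  ext; simp

lemma polyEval_sum {ι : Type*} (s : Finset ι) (f : ι → NCPoly N d μ)
    (X Y : Fin μ → Matrix k k ℂ) :
    polyEval (∑ i ∈ s, f i) X Y = ∑ i ∈ s, polyEval (f i) X Y :=
  map_sum (AddMonoidHom.mk' (fun p : NCPoly N d μ => polyEval p X Y)
    fun p q => polyEval_add p q X Y) f s

lemma polyEval_polyMul {a b c : ℕ} (p : NCPoly a b μ) (q : NCPoly b c μ)
    (X Y : Fin μ → Matrix k k ℂ) :
    polyEval (polyMul p q) X Y = polyEval p X Y * polyEval q X Y := by
  simp only [polyMul, Finsupp.sum, polyEval_sum, polyEval_single, wordEval_mul]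
  conv_rhs => rw [polyEval, polyEval, Finsupp.sum, Finsupp.sum, Matrix.sum_mul]
  simp only [Matrix.mul_sum]
  refine Finset.sum_congr rfl fun u _ => Finset.sum_congr rfl fun v _ => ?_
  exact Matrix.mul_kronecker_mul _ _ _ _

lemma polyStar_apply (p : NCPoly N d μ) (w : FreeWord μ) :
    polyStar p w = (p (FreeMonoid.ofList w.toList.reverse))ᴴ := by
  have hinj : Function.Injective
      (fun w : FreeWord μ => FreeMonoid.ofList w.toList.reverse) := by
    intro u v h
    simpa using h
  have hw : w = (fun w : FreeWord μ => FreeMonoid.ofList w.toList.reverse)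
      (FreeMonoid.ofList w.toList.reverse) := by simp
  conv_lhs => rw [hw]
  rw [polyStar, Finsupp.mapDomain_apply hinj, Finsupp.mapRange_apply]

lemma polyStar_add (p q : NCPoly N d μ) : polyStar (p + q) = polyStar p + polyStar q := by
  ext1 w
  simp [polyStar_apply]

lemma polyStar_sub (p q : NCPoly N d μ) : polyStar (p - q) = polyStar p - polyStar q := by
  ext1 w
  simp [polyStar_apply]

lemma polyStar_single (w : FreeWord μ) (c : Matrix (Fin N) (Fin d) ℂ) :
    polyStar (Finsupp.single w c) =
      Finsupp.single (FreeMonoid.ofList w.toList.reverse) cᴴ := by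
  simp [polyStar]

lemma polyEval_polyStar (p : NCPoly N d μ) {X Y : Fin μ → Matrix k k ℂ}
    (hX : ∀ i, (X i).IsHermitian) (hY : ∀ i, (Y i).IsHermitian) :
    polyEval (polyStar p) X Y = (polyEval p X Y)ᴴ := by
  induction p using Finsupp.induction_linear with
  | zero => simp [polyStar, polyEval]
  | add p q hp hq => rw [polyStar_add, polyEval_add, hp, hq, polyEval_add,
      Matrix.conjTranspose_add]
  | single w c =>
    rw [polyStar_single, polyEval_single, polyEval_single, wordEval_ofList,
      prod_map_reverse_eq_conjTranspose _ (sumElim_isHermitian hX hY)]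
    exact (Matrix.conjTranspose_kronecker _ _).symm

omit [Fintype l] [DecidableEq l] in
lemma kronId_conjTranspose_mul_polyEval_mul (p : NCPoly N d μ) (X Y : Fin μ → Matrix k k ℂ)
    (V : Matrix k l ℂ) :
    (kronId N V)ᴴ * polyEval p X Y * kronId d V =
      p.sum fun w c => Matrix.kroneckerMap (· * ·) c (Vᴴ * wordEval X Y w * V) := by
  simp only [polyEval, Finsupp.sum, Matrix.mul_sum, Matrix.sum_mul]
  refine Finset.sum_congr rfl fun w _ => ?_
  have h1 : (kronId N V)ᴴ = Matrix.kroneckerMap (· * ·) (1 : Matrix (Fin N) (Fin N) ℂ) Vᴴ := by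
    have := Matrix.conjTranspose_kronecker (1 : Matrix (Fin N) (Fin N) ℂ) V
    rwa [Matrix.conjTranspose_one] at this
  have h2 := Matrix.mul_kronecker_mul (1 : Matrix (Fin N) (Fin N) ℂ) (p w) Vᴴ (wordEval X Y w)
  have h3 := Matrix.mul_kronecker_mul (p w) (1 : Matrix (Fin d) (Fin d) ℂ)
    (Vᴴ * wordEval X Y w) V
  rw [h1, kronId]
  rw [Matrix.one_mul] at h2
  rw [Matrix.mul_one] at h3
  exact (congrArg (· * Matrix.kroneckerMap (· * ·) (1 : Matrix (Fin d) (Fin d) ℂ) V)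
    h2.symm).trans h3.symm

omit [DecidableEq k] [Fintype l] in
lemma kronId_conjTranspose_mul_self {V : Matrix k l ℂ} (hV : Vᴴ * V = 1) :
    (kronId d V)ᴴ * kronId d V = 1 := by
  have h1 : (kronId d V)ᴴ = Matrix.kroneckerMap (· * ·) (1 : Matrix (Fin d) (Fin d) ℂ) Vᴴ := by
    have := Matrix.conjTranspose_kronecker (1 : Matrix (Fin d) (Fin d) ℂ) V
    rwa [Matrix.conjTranspose_one] at this
  have h2 := Matrix.mul_kronecker_mul (1 : Matrix (Fin d) (Fin d) ℂ)
    (1 : Matrix (Fin d) (Fin d) ℂ) Vᴴ V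
  rw [h1, kronId]
  rw [Matrix.one_mul, hV] at h2
  exact h2.symm.trans (Matrix.one_kronecker_one (α := ℂ))

end Evaluation

section PencilImpliesConvex

variable {N d μ : ℕ}

def xCount (w : List (Fin μ ⊕ Fin μ)) : ℕ := (w.filter Sum.isLeft).length

def yCount (w : List (Fin μ ⊕ Fin μ)) : ℕ := (w.filter Sum.isRight).length

@[simp] lemma xCount_nil : xCount ([] : List (Fin μ ⊕ Fin μ)) = 0 := rfl

@[simp] lemma yCount_nil : yCount ([] : List (Fin μ ⊕ Fin μ)) = 0 := rfl

@[simp] lemma xCount_cons_inl (i : Fin μ) (w : List (Fin μ ⊕ Fin μ)) :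
    xCount (Sum.inl i :: w) = xCount w + 1 := rfl

@[simp] lemma xCount_cons_inr (i : Fin μ) (w : List (Fin μ ⊕ Fin μ)) :
    xCount (Sum.inr i :: w) = xCount w := rfl

@[simp] lemma yCount_cons_inl (i : Fin μ) (w : List (Fin μ ⊕ Fin μ)) :
    yCount (Sum.inl i :: w) = yCount w := rfl

@[simp] lemma yCount_cons_inr (i : Fin μ) (w : List (Fin μ ⊕ Fin μ)) :
    yCount (Sum.inr i :: w) = yCount w + 1 := rfl

@[simp] lemma xCount_append (u v : List (Fin μ ⊕ Fin μ)) :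
    xCount (u ++ v) = xCount u + xCount v := by
  simp [xCount]

@[simp] lemma yCount_append (u v : List (Fin μ ⊕ Fin μ)) :
    yCount (u ++ v) = yCount u + yCount v := by
  simp [yCount]

@[simp] lemma xCount_reverse (u : List (Fin μ ⊕ Fin μ)) : xCount u.reverse = xCount u := by
  simp [xCount, List.filter_reverse]

@[simp] lemma yCount_reverse (u : List (Fin μ ⊕ Fin μ)) : yCount u.reverse = yCount u := by
  simp [yCount, List.filter_reverse]

lemma pencil_word_cases (w : List (Fin μ ⊕ Fin μ)) (hx : xCount w ≤ 1) (hy : yCount w ≤ 1) :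
    w = [] ∨ (∃ z, w = [z]) ∨ (∃ i j, w = [Sum.inl i, Sum.inr j]) ∨
      ∃ i j, w = [Sum.inr j, Sum.inl i] := by
  rcases w with _ | ⟨a | a, _ | ⟨b | b, _ | ⟨c | c, w⟩⟩⟩ <;> simp at hx hy ⊢

variable {k l : Type*} [Fintype k] [DecidableEq k] [Fintype l] [DecidableEq l]

lemma polyEval_compress_of_isXYPencil {Λ : NCPoly N d μ} (hΛ : IsXYPencil Λ)
    {X Y : Fin μ → Matrix k k ℂ} (hX : ∀ i, (X i).IsHermitian) (hY : ∀ i, (Y i).IsHermitian)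
    {V : Matrix k l ℂ} (hV : Vᴴ * V = 1)
    (hXY : ∀ i j, Vᴴ * (X i * Y j) * V = (Vᴴ * X i * V) * (Vᴴ * Y j * V)) :
    polyEval Λ (compress V X) (compress V Y) = (kronId N V)ᴴ * polyEval Λ X Y * kronId d V := by
  rw [kronId_conjTranspose_mul_polyEval_mul]
  refine Finset.sum_congr rfl fun w hw => ?_
  obtain ⟨hx, hy⟩ := hΛ w (Finsupp.mem_support_iff.1 hw)
  rcases pencil_word_cases w.toList hx hy with h | ⟨i | i, h⟩ | ⟨i, j, h⟩ | ⟨i, j, h⟩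
  · simp [wordEval, h, hV]
  · simp [wordEval, h, compress]
  · simp [wordEval, h, compress]
  · simp [wordEval, h, compress, hXY]
  · have := congrArg Matrix.conjTranspose (hXY i j)
    simp only [Matrix.conjTranspose_mul, Matrix.conjTranspose_conjTranspose, (hX i).eq,
      (hY j).eq] at this
    simp [wordEval, h, compress, Matrix.mul_assoc] at this ⊢
    rw [this]

lemma isXYConvex_of_pencil {lam : NCPoly d d μ} (hlam : IsXYPencil lam)
    {Λ : NCPoly N d μ} (hΛ : IsXYPencil Λ) :
    IsXYConvex (lam + polyMul (polyStar Λ) Λ) := by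
  intro n m X Y hX hY V hV hXY
  have hcX : ∀ i, (compress V X i).IsHermitian := fun i => by
    simpa [compress] using Matrix.isHermitian_conjTranspose_mul_mul V (hX i)
  have hcY : ∀ i, (compress V Y i).IsHermitian := fun i => by
    simpa [compress] using Matrix.isHermitian_conjTranspose_mul_mul V (hY i)
  unfold loewnerLE
  rw [polyEval_add, polyEval_add, polyEval_polyMul, polyEval_polyMul, polyEval_polyStar Λ hX hY,
    polyEval_polyStar Λ hcX hcY, polyEval_compress_of_isXYPencil hlam hX hY hV hXY,
    polyEval_compress_of_isXYPencil hΛ hX hY hV hXY]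
  have hW := kronId_conjTranspose_mul_self (d := N) hV
  set W := kronId N V
  set U := kronId d V
  set A := polyEval Λ X Y
  have key := Matrix.posSemidef_conjTranspose_mul_self (((1 - W * Wᴴ) * (A * U)))
  convert key using 1
  have h2 : (1 - W * Wᴴ)ᴴ * (1 - W * Wᴴ) = 1 - W * Wᴴ := by
    have : W * Wᴴ * (W * Wᴴ) = W * Wᴴ := by
      rw [Matrix.mul_assoc, ← Matrix.mul_assoc Wᴴ, hW, Matrix.one_mul]
    simp only [Matrix.conjTranspose_sub, Matrix.conjTranspose_one, Matrix.conjTranspose_mul,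
      Matrix.conjTranspose_conjTranspose, Matrix.sub_mul, Matrix.mul_sub, Matrix.one_mul,
      Matrix.mul_one, this]
    abel
  rw [Matrix.conjTranspose_mul (1 - W * Wᴴ), Matrix.mul_assoc (A * U)ᴴ,
    ← Matrix.mul_assoc _ _ (A * U), h2]
  simp only [Matrix.mul_add, Matrix.add_mul, Matrix.sub_mul, Matrix.mul_sub, Matrix.one_mul,
    Matrix.conjTranspose_mul, Matrix.conjTranspose_conjTranspose, Matrix.mul_assoc]
  abel

end PencilImpliesConvex

section ConvexImpliesSeparatelyConvex

variable {d μ : ℕ}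

lemma IsXYConvex.of_fintype {p : NCPoly d d μ} (hp : IsXYConvex p) {k : Type*} [Fintype k]
    [DecidableEq k] {m : ℕ} (X Y : Fin μ → Matrix k k ℂ) (hX : ∀ i, (X i).IsHermitian)
    (hY : ∀ i, (Y i).IsHermitian) (V : Matrix k (Fin m) ℂ) (hV : Vᴴ * V = 1)
    (hXY : ∀ i j, Vᴴ * (X i * Y j) * V = (Vᴴ * X i * V) * (Vᴴ * Y j * V)) :
    loewnerLE (polyEval p (compress V X) (compress V Y))
      ((kronId d V)ᴴ * polyEval p X Y * kronId d V) := by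
  set e : Fin (Fintype.card k) ≃ k := (Fintype.equivFin k).symm
  have hmul : ∀ A : Matrix k k ℂ, (V.submatrix e id)ᴴ * A.submatrix e e * V.submatrix e id =
      Vᴴ * A * V := by
    intro A
    rw [Matrix.conjTranspose_submatrix, Matrix.submatrix_mul_equiv, Matrix.submatrix_mul_equiv,
      Matrix.submatrix_id_id]
  have h := hp (Fintype.card k) m (fun i => (X i).submatrix e e) (fun i => (Y i).submatrix e e)
    (fun i => (hX i).submatrix e) (fun i => (hY i).submatrix e) (V.submatrix e id)
    (by rw [Matrix.conjTranspose_submatrix, Matrix.submatrix_mul_equiv, hV,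
          Matrix.submatrix_id_id])
    (by
      intro i j
      rw [Matrix.submatrix_mul_equiv, hmul, hmul, hmul, hXY])
  have hc : ∀ Z : Fin μ → Matrix k k ℂ,
      compress (V.submatrix e id) (fun i => (Z i).submatrix e e) = compress V Z :=
    fun Z => funext fun i => hmul (Z i)
  rw [hc, hc, polyEval_submatrix] at h
  have hk : kronId d (V.submatrix e id) = (kronId d V).submatrix (Prod.map id e) id := by
    ext i j
    rfl
  have h2 := Matrix.submatrix_mul_equiv (polyEval p X Y) (kronId d V) (Prod.map id e)
    (Equiv.prodCongr (Equiv.refl (Fin d)) e) (id : Fin d × Fin m → Fin d × Fin m)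
  have h3 := Matrix.submatrix_mul_equiv ((kronId d V)ᴴ) (polyEval p X Y * kronId d V)
    (id : Fin d × Fin m → Fin d × Fin m) (Equiv.prodCongr (Equiv.refl (Fin d)) e)
    (id : Fin d × Fin m → Fin d × Fin m)
  have hcoe : ⇑(Equiv.prodCongr (Equiv.refl (Fin d)) e) = Prod.map id ⇑e := rfl
  rw [hcoe] at h2 h3
  rw [hk, Matrix.conjTranspose_submatrix, Matrix.mul_assoc, h2, h3, Matrix.submatrix_id_id] at h
  rwa [Matrix.mul_assoc]

lemma IsXYConvex.convexCombination {p : NCPoly d d μ} (hp : IsXYConvex p) {n : ℕ}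
    (X₁ X₂ Y₁ Y₂ : Fin μ → Matrix (Fin n) (Fin n) ℂ) (hX₁ : ∀ i, (X₁ i).IsHermitian)
    (hX₂ : ∀ i, (X₂ i).IsHermitian) (hY₁ : ∀ i, (Y₁ i).IsHermitian)
    (hY₂ : ∀ i, (Y₂ i).IsHermitian) {t : ℝ} (ht₀ : 0 ≤ t) (ht₁ : t ≤ 1)
    (hXY : ∀ i j, t • (X₁ i * Y₁ j) + (1 - t) • (X₂ i * Y₂ j) =
      (t • X₁ i + (1 - t) • X₂ i) * (t • Y₁ j + (1 - t) • Y₂ j)) :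
    loewnerLE (polyEval p (fun i => t • X₁ i + (1 - t) • X₂ i)
        (fun i => t • Y₁ i + (1 - t) • Y₂ i))
      (t • polyEval p X₁ Y₁ + (1 - t) • polyEval p X₂ Y₂) := by
  set V : Matrix (Fin n ⊕ Fin n) (Fin n) ℂ :=
    Matrix.fromRows (Real.sqrt t • (1 : Matrix (Fin n) (Fin n) ℂ))
      (Real.sqrt (1 - t) • (1 : Matrix (Fin n) (Fin n) ℂ)) with hVdef
  have hVA : ∀ A B : Matrix (Fin n) (Fin n) ℂ,
      Vᴴ * Matrix.fromBlocks A 0 0 B * V = t • A + (1 - t) • B := by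
    intro A B
    rw [hVdef, Matrix.conjTranspose_fromRows_eq_fromCols_conjTranspose, Matrix.mul_assoc,
      Matrix.fromBlocks_mul_fromRows, Matrix.fromCols_mul_fromRows]
    simp only [Matrix.conjTranspose_smul, Matrix.conjTranspose_one, star_trivial,
      smul_zero, add_zero, zero_add, Matrix.smul_mul, Matrix.one_mul, Matrix.mul_smul,
      Matrix.mul_one, smul_smul, Real.mul_self_sqrt ht₀,
      Real.mul_self_sqrt (sub_nonneg.2 ht₁)]
  have hV : Vᴴ * V = 1 := by
    have := hVA 1 1
    rw [Matrix.fromBlocks_one, Matrix.mul_one] at this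
    rw [this, ← add_smul]
    simp
  have hblock : ∀ (w : FreeWord μ), wordEval (fun i => Matrix.fromBlocks (X₁ i) 0 0 (X₂ i))
      (fun i => Matrix.fromBlocks (Y₁ i) 0 0 (Y₂ i)) w =
      Matrix.fromBlocks (wordEval X₁ Y₁ w) 0 0 (wordEval X₂ Y₂ w) := by
    intro w
    simp only [wordEval]
    induction w.toList with
    | nil => simp [Matrix.fromBlocks_one]
    | cons z l ih =>
      rw [List.map_cons, List.prod_cons, ih]
      rcases z with i | i <;> simp [Matrix.fromBlocks_multiply]
  have h := hp.of_fintype (fun i => Matrix.fromBlocks (X₁ i) 0 0 (X₂ i))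
    (fun i => Matrix.fromBlocks (Y₁ i) 0 0 (Y₂ i))
    (fun i => Matrix.IsHermitian.fromBlocks (hX₁ i) (by simp) (hX₂ i))
    (fun i => Matrix.IsHermitian.fromBlocks (hY₁ i) (by simp) (hY₂ i)) V hV
    (by
      intro i j
      rw [hVA, hVA, Matrix.fromBlocks_multiply]
      simp only [Matrix.mul_zero, Matrix.zero_mul, add_zero, zero_add]
      rw [hVA, hXY])
  rw [kronId_conjTranspose_mul_polyEval_mul] at h
  have hcomp : ∀ A B : Fin μ → Matrix (Fin n) (Fin n) ℂ,
      compress V (fun i => Matrix.fromBlocks (A i) 0 0 (B i)) =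
        fun i => t • A i + (1 - t) • B i := fun A B => funext fun i => hVA _ _
  simp only [hblock, hcomp, hVA] at h
  convert h using 1
  ext i j
  simp only [Matrix.add_apply, Matrix.smul_apply, polyEval_apply, Finsupp.sum, Matrix.sum_apply,
    Finset.smul_sum, ← Finset.sum_add_distrib]
  refine Finset.sum_congr rfl fun w _ => ?_
  simp only [Matrix.kroneckerMap_apply, Matrix.add_apply, Matrix.smul_apply, Complex.real_smul]
  ring

lemma IsXYConvex.isConvexInX {p : NCPoly d d μ} (hp : IsXYConvex p) : IsConvexInX p := by
  intro n X₁ X₂ Y hX₁ hX₂ hY t ht₀ ht₁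
  have hY' : (fun i => t • Y i + (1 - t) • Y i) = Y := by
    funext i
    rw [← add_smul]
    simp
  have h := hp.convexCombination X₁ X₂ Y Y hX₁ hX₂ hY hY ht₀ ht₁ (by
    intro i j
    rw [← add_smul t (1 - t) (Y j)]
    simp [Matrix.add_mul])
  rwa [hY'] at h

lemma IsXYConvex.isConvexInY {p : NCPoly d d μ} (hp : IsXYConvex p) : IsConvexInY p := by
  intro n X Y₁ Y₂ hX hY₁ hY₂ t ht₀ ht₁
  have hX' : (fun i => t • X i + (1 - t) • X i) = X := by
    funext i
    rw [← add_smul]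
    simp
  have h := hp.convexCombination X X Y₁ Y₂ hX hX hY₁ hY₂ ht₀ ht₁ (by
    intro i j
    rw [← add_smul t (1 - t) (X i)]
    simp [Matrix.mul_add])
  rwa [hX'] at h

end ConvexImpliesSeparatelyConvex

section SecondVariation

variable {d μ : ℕ}

/-- The quadratic form of `polyEval p X Y` at the vector `∑ s, e_s ⊗ e_(o s)`. -/
noncomputable def polyForm {k : Type*} [Fintype k] [DecidableEq k] (p : NCPoly d d μ)
    (o : Fin d → k) (X Y : Fin μ → Matrix k k ℂ) : ℂ :=
  ∑ w ∈ p.support, ∑ s, ∑ t, p w s t * wordEval X Y w (o s) (o t)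

lemma IsConvexInX.polyForm_nonneg {p : NCPoly d d μ} (hp : IsConvexInX p) {k : Type*}
    [Fintype k] [DecidableEq k] (o : Fin d → k) (X H Y : Fin μ → Matrix k k ℂ)
    (hX : ∀ i, (X i).IsHermitian) (hH : ∀ i, (H i).IsHermitian) (hY : ∀ i, (Y i).IsHermitian) :
    0 ≤ polyForm p o (fun i => X i + H i) Y + polyForm p o (fun i => X i - H i) Y
      - 2 * polyForm p o X Y := by
  set e : Fin (Fintype.card k) ≃ k := (Fintype.equivFin k).symm
  have hconv := hp (Fintype.card k) (fun i => (X i + H i).submatrix e e)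
    (fun i => (X i - H i).submatrix e e) (fun i => (Y i).submatrix e e)
    (fun i => ((hX i).add (hH i)).submatrix e) (fun i => ((hX i).sub (hH i)).submatrix e)
    (fun i => (hY i).submatrix e) (1 / 2) (by norm_num) (by norm_num)
  have hmid : (fun i => (1 / 2 : ℝ) • (X i + H i).submatrix e e +
      (1 - 1 / 2 : ℝ) • (X i - H i).submatrix e e) = fun i => (X i).submatrix e e := by
    funext i
    ext a b
    simp
    ring
  rw [hmid, polyEval_submatrix, polyEval_submatrix, polyEval_submatrix] at hconv
  set ξ : Fin d × Fin (Fintype.card k) → ℂ := fun q => if q.2 = e.symm (o q.1) then 1 else 0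
    with hξ
  have hform : ∀ Z : Fin μ → Matrix k k ℂ,
      star ξ ⬝ᵥ ((polyEval p Z Y).submatrix (Prod.map id e) (Prod.map id e) *ᵥ ξ) =
        polyForm p o Z Y := by
    intro Z
    simp only [dotProduct, Matrix.mulVec, Fintype.sum_prod_type, hξ, Pi.star_apply,
      Matrix.submatrix_apply, Prod.map_apply, id, polyEval_apply, polyForm, mul_ite, mul_one,
      mul_zero, Finset.sum_ite_eq', Finset.mem_univ, if_true, apply_ite (star : ℂ → ℂ), star_one,
      star_zero, ite_mul, one_mul, zero_mul, Equiv.apply_symm_apply,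
      Finsupp.sum]
    rw [Finset.sum_comm' (t' := Finset.univ) (s' := fun _ => p.support) (by simp)]
    refine Finset.sum_congr rfl fun s _ => ?_
    rw [Finset.sum_comm]
  have h := hconv.dotProduct_mulVec_nonneg ξ
  rw [Matrix.sub_mulVec, Matrix.add_mulVec, Matrix.smul_mulVec, Matrix.smul_mulVec,
    dotProduct_sub, dotProduct_add, dotProduct_smul, dotProduct_smul, hform, hform, hform] at h
  have h2 : (0 : ℂ) ≤ 2 * ((1 / 2 : ℝ) • polyForm p o (fun i => X i + H i) Y +
      (1 - 1 / 2 : ℝ) • polyForm p o (fun i => X i - H i) Y - polyForm p o X Y) :=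
    mul_nonneg (by norm_num) h
  convert h2 using 1
  simp only [Complex.real_smul]
  push_cast
  ring

/-- The coefficient of `t` in the product over `w` of `Z z + t H z`. -/
def firstVar {α R : Type*} [Ring R] (Z H : α → R) : List α → R
  | [] => 0
  | z :: w => Z z * firstVar Z H w + H z * (w.map Z).prod

/-- The coefficient of `t ^ 2` in the product over `w` of `Z z + t H z`. -/
def secondVar {α R : Type*} [Ring R] (Z H : α → R) : List α → R
  | [] => 0
  | z :: w => Z z * secondVar Z H w + H z * firstVar Z H w

lemma exists_prod_expansion {α k : Type*} [Fintype k] [DecidableEq k]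
    (Z H : α → Matrix k k ℂ) (w : List α) :
    ∃ R : ℝ → Matrix k k ℂ, Continuous R ∧ ∀ t : ℝ,
      (w.map fun z => Z z + t • H z).prod =
        (w.map Z).prod + t • firstVar Z H w + t ^ 2 • secondVar Z H w + t ^ 3 • R t := by
  induction w with
  | nil => exact ⟨fun _ => 0, continuous_const, fun t => by simp [firstVar, secondVar]⟩
  | cons z w ih =>
    obtain ⟨R, hR, h⟩ := ih
    refine ⟨fun t => Z z * R t + H z * secondVar Z H w + t • (H z * R t), by fun_prop, ?_⟩
    intro t
    rw [List.map_cons, List.prod_cons, h, List.map_cons, List.prod_cons, firstVar, secondVar]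
    simp only [Matrix.add_mul, Matrix.mul_add, Matrix.smul_mul, Matrix.mul_smul, smul_add,
      smul_smul]
    module

lemma IsConvexInX.secondVar_nonneg {p : NCPoly d d μ} (hp : IsConvexInX p) {k : Type*}
    [Fintype k] [DecidableEq k] (o : Fin d → k) (Z H : Fin μ ⊕ Fin μ → Matrix k k ℂ)
    (hZ : ∀ z, (Z z).IsHermitian) (hH : ∀ z, (H z).IsHermitian) (hHy : ∀ i, H (Sum.inr i) = 0) :
    0 ≤ ∑ w ∈ p.support, ∑ s, ∑ t, p w s t * secondVar Z H w.toList (o s) (o t) := by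
  choose R hR hexp using fun w : FreeWord μ => exists_prod_expansion Z H w.toList
  set q := ∑ w ∈ p.support, ∑ s, ∑ t, p w s t * secondVar Z H w.toList (o s) (o t) with hq
  set X : Fin μ → Matrix k k ℂ := fun i => Z (Sum.inl i)
  set Y : Fin μ → Matrix k k ℂ := fun i => Z (Sum.inr i)
  set r : ℝ → ℂ := fun τ => ∑ w ∈ p.support, ∑ s, ∑ t, p w s t * R w τ (o s) (o t) with hr
  have hrc : Continuous r := by
    refine continuous_finsetSum _ fun w _ => continuous_finsetSum _ fun s _ =>
      continuous_finsetSum _ fun t _ => continuous_const.mul ?_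
    exact (continuous_apply_apply (o s) (o t)).comp (hR w)
  set g₁ := ∑ w ∈ p.support, ∑ s, ∑ t, p w s t * firstVar Z H w.toList (o s) (o t)
  have hword : ∀ (τ : ℝ) (w : FreeWord μ), wordEval (fun i => X i + τ • H (Sum.inl i)) Y w =
      wordEval X Y w + τ • firstVar Z H w.toList + τ ^ 2 • secondVar Z H w.toList
        + τ ^ 3 • R w τ := by
    intro τ w
    have h1 : Sum.elim (fun i => X i + τ • H (Sum.inl i)) Y = fun z => Z z + τ • H z := by
      funext z
      rcases z with i | i
      · rfl
      · simp [hHy, Y]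
    have h2 : Sum.elim X Y = Z := by
      funext z
      rcases z with i | i <;> rfl
    rw [wordEval, wordEval, h1, h2, hexp]
  have hform : ∀ τ : ℝ, polyForm p o (fun i => X i + τ • H (Sum.inl i)) Y =
      polyForm p o X Y + τ * g₁ + τ ^ 2 * q + τ ^ 3 * r τ := by
    intro τ
    simp only [polyForm, hword, g₁, hq, hr, Finset.mul_sum, ← Finset.sum_add_distrib,
      Matrix.add_apply, Matrix.smul_apply, Complex.real_smul]
    refine Finset.sum_congr rfl fun w _ => Finset.sum_congr rfl fun s _ =>
      Finset.sum_congr rfl fun t _ => ?_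
    push_cast
    ring
  have hpos : ∀ τ : ℝ, 0 < τ → (0 : ℂ) ≤ 2 * q + τ * (r τ - r (-τ)) := by
    intro τ hτ
    have h := hp.polyForm_nonneg o X (fun i => τ • H (Sum.inl i)) Y (fun i => hZ _)
      (fun i => by rw [Matrix.IsHermitian, Matrix.conjTranspose_smul, star_trivial, (hH _).eq]) (fun i => hZ _)
    have hneg : (fun i => X i - τ • H (Sum.inl i)) = fun i => X i + (-τ) • H (Sum.inl i) := by
      funext i
      rw [neg_smul, sub_eq_add_neg]
    rw [hneg, hform, hform] at h
    have h2 : (0 : ℂ) ≤ ((τ ^ 2)⁻¹ : ℝ) * (polyForm p o X Y + τ * g₁ + τ ^ 2 * q + τ ^ 3 * r τ +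
        (polyForm p o X Y + (-τ : ℝ) * g₁ + (-τ : ℝ) ^ 2 * q + (-τ : ℝ) ^ 3 * r (-τ)) -
        2 * polyForm p o X Y) :=
      mul_nonneg (by exact_mod_cast (by positivity : (0 : ℝ) ≤ (τ ^ 2)⁻¹)) h
    convert h2 using 1
    have : (τ : ℂ) ≠ 0 := by exact_mod_cast hτ.ne'
    push_cast
    field_simp
    ring
  have hlim : Filter.Tendsto (fun τ : ℝ => 2 * q + τ * (r τ - r (-τ)))
      (nhdsWithin 0 (Set.Ioi 0)) (nhds (2 * q)) := by
    have hc : Continuous fun τ : ℝ => 2 * q + τ * (r τ - r (-τ)) := by fun_prop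
    have := (hc.tendsto 0).mono_left (nhdsWithin_le_nhds (s := Set.Ioi 0))
    simpa using this
  have h2q : 0 ≤ 2 * q :=
    ge_of_tendsto hlim (Filter.eventually_of_mem self_mem_nhdsWithin fun τ hτ => hpos τ hτ)
  have : q = (1 / 2 : ℂ) * (2 * q) := by ring
  rw [this]
  refine mul_nonneg ?_ h2q
  have : ((1 / 2 : ℝ) : ℂ) = 1 / 2 := by push_cast; rfl
  rw [← this]
  exact_mod_cast (by norm_num : (0 : ℝ) ≤ 1 / 2)

end SecondVariation

section FockSpace

variable {α : Type*} [Fintype α] [DecidableEq α]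

/-- Words of bounded length, indexing a truncated full Fock space. -/
abbrev BoundedWord (α : Type*) (L : ℕ) := {w : List α // w.length ≤ L}

noncomputable instance (L : ℕ) : Fintype (BoundedWord α L) :=
  (List.finite_length_le α L).fintype

/-- The sum of the creation and annihilation operators of the letter `z`. -/
def fockShift (L : ℕ) (z : α) : Matrix (BoundedWord α L) (BoundedWord α L) ℂ :=
  Matrix.of fun u v => if u.1 = z :: v.1 ∨ v.1 = z :: u.1 then 1 else 0

omit [Fintype α] in
lemma fockShift_isHermitian (L : ℕ) (z : α) : (fockShift L z).IsHermitian := by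
  ext u v
  simp only [fockShift, Matrix.conjTranspose_apply, Matrix.of_apply, apply_ite star, star_one,
    star_zero, or_comm]

lemma fockShift_prod_apply (L : ℕ) (w : List α) (u : BoundedWord α L)
    (h : w.length ≤ u.1.length) :
    (w.map (fockShift L)).prod u ⟨[], Nat.zero_le L⟩ = if u.1 = w then 1 else 0 := by
  induction w generalizing u with
  | nil => simp [Matrix.one_apply, Subtype.ext_iff]
  | cons z w ih =>
    rw [List.map_cons, List.prod_cons, Matrix.mul_apply]
    have hterm : ∀ v : BoundedWord α L, fockShift L z u v *
        (w.map (fockShift L)).prod v ⟨[], Nat.zero_le L⟩ =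
        if u.1 = z :: v.1 ∧ v.1 = w then 1 else 0 := by
      intro v
      rw [List.length_cons] at h
      by_cases h1 : u.1 = z :: v.1
      · have hv : w.length ≤ v.1.length := by
          rw [h1, List.length_cons] at h
          omega
        rw [ih v hv]
        simp [fockShift, h1]
      · by_cases h2 : v.1 = z :: u.1
        · have hv : w.length + 2 ≤ v.1.length := by
            rw [h2, List.length_cons]
            omega
          rw [ih v (by omega)]
          have hne : v.1 ≠ w := by
            rintro rfl
            omega
          simp [hne]
        · simp [fockShift, h1, h2]
    rw [Finset.sum_congr rfl fun v _ => hterm v]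
    by_cases hu : u.1 = z :: w
    · have hw : w.length ≤ L := by
        have := u.2
        rw [hu, List.length_cons] at this
        omega
      rw [if_pos hu, Finset.sum_eq_single ⟨w, hw⟩]
      · simp [hu]
      · intro v _ hv
        rw [if_neg]
        exact fun h => hv (Subtype.ext h.2)
      · simp
    · rw [if_neg hu]
      refine Finset.sum_eq_zero fun v _ => if_neg ?_
      rintro ⟨h1, h2⟩
      exact hu (h2 ▸ h1)

/-- Hermitian matrices under which the short words applied to a basis vector are linearly
independent, together with a dual system. -/
lemma exists_hermitian_dual_words (α : Type*) [Fintype α] [DecidableEq α] (L : ℕ) :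
    ∃ (S : α → Matrix (BoundedWord α L) (BoundedWord α L) ℂ) (o : BoundedWord α L)
      (Ψ : List α → BoundedWord α L → ℂ), (∀ z, (S z).IsHermitian) ∧
      ∀ u w : List α, u.length ≤ L → w.length ≤ L →
        ∑ i, Ψ u i * (w.map S).prod i o = if u = w then 1 else 0 := by
  set M : Matrix (BoundedWord α L) (BoundedWord α L) ℂ :=
    Matrix.of fun u w => (w.1.map (fockShift L)).prod u ⟨[], Nat.zero_le L⟩ with hM
  have htri : M.BlockTriangular (fun u => u.1.length) := by
    intro u w h
    have h' : w.1.length < u.1.length := h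
    rw [hM, Matrix.of_apply, fockShift_prod_apply _ _ _ h'.le, if_neg]
    intro h2
    rw [h2] at h'
    exact lt_irrefl _ h'
  have hdet : M.det = 1 := by
    rw [htri.det]
    refine Finset.prod_eq_one fun l _ => ?_
    have : M.toSquareBlock (fun u => u.1.length) l = 1 := by
      ext ⟨u, hu⟩ ⟨w, hw⟩
      rw [Matrix.toSquareBlock, Matrix.toSquareBlockProp, Matrix.one_apply]
      simp only [Matrix.toBlock_apply, hM, Matrix.of_apply, Subtype.mk.injEq]
      rw [fockShift_prod_apply _ _ _ (hw.trans hu.symm).le]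
      simp [Subtype.ext_iff]
    rw [this, Matrix.det_one]
  have hinv : M⁻¹ * M = 1 := Matrix.nonsing_inv_mul M (by rw [hdet]; exact isUnit_one)
  refine ⟨fockShift L, ⟨[], Nat.zero_le L⟩,
    fun u i => if hu : u.length ≤ L then M⁻¹ ⟨u, hu⟩ i else 0, fockShift_isHermitian L, ?_⟩
  intro u w hu hw
  have h := congrFun (congrFun hinv ⟨u, hu⟩) ⟨w, hw⟩
  rw [Matrix.mul_apply, Matrix.one_apply] at h
  simpa [dif_pos hu, hM, Subtype.ext_iff] using h

end FockSpace

section MiddleMatrix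

variable {α : Type*} {m : Type*} [Fintype m]

/-- The first variation along `ψ` of a word applied to a vector: the letter `z` acts by `Z z` on
the variation and sends the unperturbed vector of the word `w` to `ψ z w`. -/
def firstTerm (Z : α → Matrix m m ℂ) (ψ : α → List α → m → ℂ) : List α → m → ℂ
  | [] => 0
  | z :: w => Z z *ᵥ firstTerm Z ψ w + ψ z w

/-- The sesquilinear second variation of a word along `φ` and `ψ`. -/
def secondTerm (Z : α → Matrix m m ℂ) (φ ψ : α → List α → m → ℂ) : List α → List α → ℂ
  | _, [] => 0
  | pre, z :: w => secondTerm Z φ ψ (z :: pre) w + star (φ z pre) ⬝ᵥ firstTerm Z ψ w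

variable {d μ : ℕ}

lemma IsConvexInX.secondTerm_nonneg [DecidableEq m] {p : NCPoly d d μ} (hp : IsConvexInX p)
    (Z : Fin μ ⊕ Fin μ → Matrix m m ℂ) (hZ : ∀ z, (Z z).IsHermitian)
    (φ : Fin d → Fin μ ⊕ Fin μ → List (Fin μ ⊕ Fin μ) → m → ℂ)
    (hφ : ∀ t k w, φ t (Sum.inr k) w = 0) :
    0 ≤ ∑ w ∈ p.support, ∑ s, ∑ t, p w s t * secondTerm Z (φ s) (φ t) [] w.toList := by
  set L := p.support.sup fun w => w.toList.length
  obtain ⟨S, o, Ψ, hS, hΨ⟩ := exists_hermitian_dual_words (Fin μ ⊕ Fin μ) L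
  set W := (List.finite_length_le (Fin μ ⊕ Fin μ) L).toFinset with hW
  set h : Fin μ ⊕ Fin μ → Matrix m (BoundedWord (Fin μ ⊕ Fin μ) L × Fin d) ℂ :=
    fun z => Matrix.of fun i a => ∑ u ∈ W, φ a.2 z u i * Ψ u a.1 with hh
  set A : Fin μ ⊕ Fin μ → Matrix (BoundedWord (Fin μ ⊕ Fin μ) L × Fin d ⊕ m)
    (BoundedWord (Fin μ ⊕ Fin μ) L × Fin d ⊕ m) ℂ :=
    fun z => Matrix.fromBlocks (Matrix.kroneckerMap (· * ·) (S z) (1 : Matrix (Fin d) (Fin d) ℂ))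
      0 0 (Z z) with hA
  set B : Fin μ ⊕ Fin μ → Matrix (BoundedWord (Fin μ ⊕ Fin μ) L × Fin d ⊕ m)
    (BoundedWord (Fin μ ⊕ Fin μ) L × Fin d ⊕ m) ℂ :=
    fun z => Matrix.fromBlocks 0 (h z)ᴴ (h z) 0 with hB
  have hAh : ∀ z, (A z).IsHermitian := fun z =>
    Matrix.IsHermitian.fromBlocks (by
      have := Matrix.conjTranspose_kronecker (S z) (1 : Matrix (Fin d) (Fin d) ℂ)
      rw [(hS z).eq, Matrix.conjTranspose_one] at this
      exact this) (by simp) (hZ z)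
  have hBh : ∀ z, (B z).IsHermitian := fun z =>
    Matrix.IsHermitian.fromBlocks Matrix.isHermitian_zero (by simp) Matrix.isHermitian_zero
  have hBy : ∀ k, B (Sum.inr k) = 0 := by
    intro k
    have : h (Sum.inr k) = 0 := by
      ext i a
      simp [hh, hφ]
    simp [hB, this]
  set e : Fin d → (BoundedWord (Fin μ ⊕ Fin μ) L × Fin d ⊕ m) → ℂ :=
    fun t => Pi.single (Sum.inl (o, t)) 1 with he
  set ω : List (Fin μ ⊕ Fin μ) → Fin d → BoundedWord (Fin μ ⊕ Fin μ) L × Fin d → ℂ :=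
    fun w t a => (w.map S).prod a.1 o * (1 : Matrix (Fin d) (Fin d) ℂ) a.2 t with hω
  have hprod : ∀ w t, (w.map A).prod *ᵥ e t = Sum.elim (ω w t) 0 := by
    intro w t
    induction w with
    | nil =>
      funext a
      rcases a with ⟨a, s⟩ | a
      · by_cases h1 : a = o <;> by_cases h2 : s = t <;>
          simp [he, hω, Matrix.one_apply, h1, h2]
      · simp [he]
    | cons z w ih =>
      rw [List.map_cons, List.prod_cons, ← Matrix.mulVec_mulVec, ih, hA,
        Matrix.fromBlocks_mulVec, Sum.elim_comp_inl, Sum.elim_comp_inr]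
      congr 1
      · funext a
        simp only [Matrix.zero_mulVec, add_zero, hω, List.map_cons, List.prod_cons,
          Matrix.mul_apply, Matrix.mulVec, dotProduct, Fintype.sum_prod_type,
          Matrix.kroneckerMap_apply, Finset.sum_mul]
        refine Finset.sum_congr rfl fun b _ => ?_
        rw [Finset.sum_eq_single a.2]
        · simp [mul_assoc]
        · intro c _ hc
          simp [Matrix.one_apply, hc.symm]
        · simp
      · simp
  have hhω : ∀ z w t, w.length ≤ L → h z *ᵥ ω w t = φ t z w := by
    intro z w t hw
    funext i
    simp only [hh, hω, Matrix.mulVec, dotProduct, Matrix.of_apply, Fintype.sum_prod_type]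
    calc _ = ∑ a, ∑ u ∈ W, φ t z u i * (Ψ u a * (w.map S).prod a o) := by
          refine Finset.sum_congr rfl fun a _ => ?_
          rw [Finset.sum_eq_single t]
          · rw [Matrix.one_apply_eq, mul_one, Finset.sum_mul]
            exact Finset.sum_congr rfl fun u _ => by ring
          · intro s _ hs
            simp [hs]
          · simp
      _ = ∑ u ∈ W, φ t z u i * if u = w then 1 else 0 := by
          rw [Finset.sum_comm]
          refine Finset.sum_congr rfl fun u hu => ?_
          rw [← Finset.mul_sum, hΨ u w (by simpa [hW] using hu) hw]
      _ = φ t z w i := by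
          have : w ∈ W := by simpa [hW] using hw
          simp [this]
  have hfirst : ∀ w t, w.length ≤ L →
      firstVar A B w *ᵥ e t = Sum.elim (0 : BoundedWord (Fin μ ⊕ Fin μ) L × Fin d → ℂ)
        (firstTerm Z (φ t) w) := by
    intro w t hw
    induction w with
    | nil =>
      funext a
      rcases a with a | a <;> simp [firstVar, firstTerm]
    | cons z w ih =>
      rw [List.length_cons] at hw
      rw [firstVar, Matrix.add_mulVec, ← Matrix.mulVec_mulVec, ← Matrix.mulVec_mulVec,
        ih (by omega), hprod, hA, hB, Matrix.fromBlocks_mulVec,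
        Matrix.fromBlocks_mulVec, Sum.elim_comp_inl, Sum.elim_comp_inr, Sum.elim_comp_inl,
        Sum.elim_comp_inr, hhω z w t (by omega)]
      funext a
      rcases a with a | a <;> simp [firstTerm]
  have hsecond : ∀ w pre s t, pre.length + w.length ≤ L →
      star ((pre.map A).prod *ᵥ e s) ⬝ᵥ (secondVar A B w *ᵥ e t) =
        secondTerm Z (φ s) (φ t) pre w := by
    intro w
    induction w with
    | nil => intro pre s t _; simp [secondVar, secondTerm]
    | cons z w ih =>
      intro pre s t hl
      rw [List.length_cons] at hl
      rw [secondVar, secondTerm, ← ih (z :: pre) s t (by rw [List.length_cons]; omega),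
        Matrix.add_mulVec, dotProduct_add, ← Matrix.mulVec_mulVec, ← Matrix.mulVec_mulVec]
      congr 1
      · rw [List.map_cons, List.prod_cons, ← Matrix.mulVec_mulVec, Matrix.star_mulVec (A z),
          (hAh z).eq, Matrix.dotProduct_mulVec]
      · rw [hprod, hfirst _ _ (by omega), hB, Matrix.fromBlocks_mulVec, Sum.elim_comp_inl,
          Sum.elim_comp_inr,
          ← hhω z pre s (by omega), Matrix.star_mulVec, ← Matrix.dotProduct_mulVec]
        simp [dotProduct, Fintype.sum_sum_type]
  have key := hp.secondVar_nonneg (fun t => Sum.inl (o, t)) A B hAh hBh hBy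
  convert key using 1
  refine Finset.sum_congr rfl fun w hw => Finset.sum_congr rfl fun s _ =>
    Finset.sum_congr rfl fun t _ => ?_
  have hw' : w.toList.length ≤ L :=
    Finset.le_sup (f := fun w : FreeWord μ => w.toList.length) hw
  rw [← hsecond w.toList [] s t (by simpa using hw')]
  have hstar : star (e s) = Pi.single (Sum.inl (o, s)) 1 := by
    funext a
    simp [he, Pi.single_apply, apply_ite (star : ℂ → ℂ)]
  rw [List.map_nil, List.prod_nil, Matrix.one_mulVec, hstar, single_one_dotProduct, he,
    Matrix.mulVec_single_one, Matrix.col_apply]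

end MiddleMatrix

section SecondTerm

variable {α : Type*} {m : Type*} [Fintype m] (Z : α → Matrix m m ℂ)

lemma firstTerm_add (ψ ψ' : α → List α → m → ℂ) (w : List α) :
    firstTerm Z (ψ + ψ') w = firstTerm Z ψ w + firstTerm Z ψ' w := by
  induction w with
  | nil => simp [firstTerm]
  | cons z w ih =>
    simp only [firstTerm, ih, Matrix.mulVec_add, Pi.add_apply]
    abel

lemma firstTerm_smul (c : ℂ) (ψ : α → List α → m → ℂ) (w : List α) :
    firstTerm Z (c • ψ) w = c • firstTerm Z ψ w := by
  induction w with
  | nil => simp [firstTerm]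
  | cons z w ih => simp only [firstTerm, ih, Matrix.mulVec_smul, Pi.smul_apply, smul_add]

lemma secondTerm_add_left (φ φ' ψ : α → List α → m → ℂ) (pre w : List α) :
    secondTerm Z (φ + φ') ψ pre w = secondTerm Z φ ψ pre w + secondTerm Z φ' ψ pre w := by
  induction w generalizing pre with
  | nil => simp [secondTerm]
  | cons z w ih =>
    simp only [secondTerm, ih, Pi.add_apply, star_add, add_dotProduct]
    ring

lemma secondTerm_add_right (φ ψ ψ' : α → List α → m → ℂ) (pre w : List α) :
    secondTerm Z φ (ψ + ψ') pre w = secondTerm Z φ ψ pre w + secondTerm Z φ ψ' pre w := by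
  induction w generalizing pre with
  | nil => simp [secondTerm]
  | cons z w ih =>
    simp only [secondTerm, ih, firstTerm_add, dotProduct_add]
    ring

lemma secondTerm_smul_left (c : ℂ) (φ ψ : α → List α → m → ℂ) (pre w : List α) :
    secondTerm Z (c • φ) ψ pre w = star c * secondTerm Z φ ψ pre w := by
  induction w generalizing pre with
  | nil => simp [secondTerm]
  | cons z w ih =>
    simp only [secondTerm, ih, Pi.smul_apply, star_smul, smul_dotProduct, smul_eq_mul]
    ring

lemma secondTerm_smul_right (c : ℂ) (φ ψ : α → List α → m → ℂ) (pre w : List α) :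
    secondTerm Z φ (c • ψ) pre w = c * secondTerm Z φ ψ pre w := by
  induction w generalizing pre with
  | nil => simp [secondTerm]
  | cons z w ih =>
    simp only [secondTerm, ih, firstTerm_smul, dotProduct_smul, smul_eq_mul]
    ring

variable {Z}

lemma firstTerm_eq_zero {ψ : α → List α → m → ℂ} {w : List α}
    (h : ∀ r z c, w = r ++ z :: c → ψ z c = 0) : firstTerm Z ψ w = 0 := by
  induction w with
  | nil => rfl
  | cons z w ih =>
    rw [firstTerm, ih fun r z' c hw => h (z :: r) z' c (by rw [hw]; rfl), h [] z w rfl,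
      Matrix.mulVec_zero, add_zero]

lemma secondTerm_eq_zero {φ ψ : α → List α → m → ℂ} {pre w : List α}
    (h : ∀ r z b z' c, w = r ++ z :: (b ++ z' :: c) → φ z (r.reverse ++ pre) = 0 ∨ ψ z' c = 0) :
    secondTerm Z φ ψ pre w = 0 := by
  induction w generalizing pre with
  | nil => rfl
  | cons z w ih =>
    rw [secondTerm, ih, zero_add]
    · by_cases hφ : φ z pre = 0
      · simp [hφ]
      · rw [firstTerm_eq_zero, dotProduct_zero]
        intro r z' c hw
        exact (h [] z r z' c (by rw [hw]; rfl)).resolve_left hφ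
    · intro r z₁ b z₂ c hw
      have := h (z :: r) z₁ b z₂ c (by rw [hw]; rfl)
      simpa using this

lemma firstTerm_append_of_single [DecidableEq m] {ψ : α → List α → m → ℂ} {z₀ : α} {c : List α}
    (hψ : ∀ z u, ψ z u ≠ 0 → u = c) (r : List α) :
    firstTerm Z ψ (r ++ z₀ :: c) = (r.map Z).prod *ᵥ ψ z₀ c := by
  induction r with
  | nil =>
    rw [List.nil_append, firstTerm, firstTerm_eq_zero, Matrix.mulVec_zero, zero_add]
    · simp
    · intro r z u hc
      by_contra hne
      have := hψ z u hne
      rw [this] at hc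
      have := congrArg List.length hc
      simp at this
      omega
  | cons z r ih =>
    rw [List.cons_append, firstTerm, ih, List.map_cons, List.prod_cons, Matrix.mulVec_mulVec]
    have : ψ z (r ++ z₀ :: c) = 0 := by
      by_contra hne
      have := congrArg List.length (hψ z _ hne)
      simp at this
      omega
    rw [this, add_zero]

lemma secondTerm_append_of_single {φ ψ : α → List α → m → ℂ} {z₀ : α} {u₀ : List α}
    (hφ : ∀ z u, φ z u ≠ 0 → u = u₀) (r pre w : List α) (hr : r.reverse ++ pre = u₀) :
    secondTerm Z φ ψ pre (r ++ z₀ :: w) = star (φ z₀ u₀) ⬝ᵥ firstTerm Z ψ w := by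
  induction r generalizing pre with
  | nil =>
    rw [List.nil_append, secondTerm, secondTerm_eq_zero, zero_add]
    · rw [← hr]; rfl
    · intro r z b z' c _
      left
      by_contra hne
      have h := congrArg List.length ((hφ z _ hne).trans hr.symm)
      simp at h
      omega
  | cons z r ih =>
    rw [List.cons_append, secondTerm, ih (z :: pre) (by simpa using hr)]
    have : φ z pre = 0 := by
      by_contra hne
      have h := congrArg List.length ((hφ z _ hne).trans hr.symm)
      simp at h
      omega
    simp [this]

end SecondTerm

section Support

lemma eq_zero_of_sesquilinear_nonneg {b c e : ℂ}
    (h : ∀ z : ℂ, 0 ≤ z * b + star z * c + star z * z * e) : c = 0 := by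
  have key : ∀ f : ℂ, (∀ τ : ℝ, 0 ≤ τ * f + τ ^ 2 * e) → f = 0 := by
    intro f hf
    have him : ∀ τ : ℝ, τ * f.im + τ ^ 2 * e.im = 0 := by
      intro τ
      have := (Complex.le_def.1 (hf τ)).2
      simpa [← Complex.ofReal_pow] using this.symm
    have hre : ∀ τ : ℝ, 0 ≤ τ * f.re + τ ^ 2 * e.re := by
      intro τ
      have := (Complex.le_def.1 (hf τ)).1
      simpa [← Complex.ofReal_pow] using this
    apply Complex.ext
    · by_contra hne
      have hne : f.re ≠ 0 := hne
      have h1 := hre (-f.re / (|e.re| + 1))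
      have hpos : 0 < |e.re| + 1 := by positivity
      have hle : e.re ≤ |e.re| := le_abs_self _
      have h2 : 0 ≤ (-f.re / (|e.re| + 1) * f.re + (-f.re / (|e.re| + 1)) ^ 2 * e.re) *
          (|e.re| + 1) ^ 2 := mul_nonneg h1 (by positivity)
      have h3 : (-f.re / (|e.re| + 1) * f.re + (-f.re / (|e.re| + 1)) ^ 2 * e.re) *
          (|e.re| + 1) ^ 2 = f.re ^ 2 * (e.re - |e.re| - 1) := by
        field_simp
        ring
      rw [h3] at h2
      have : 0 < f.re ^ 2 := by positivity
      nlinarith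
    · have h1 := him 1
      have h2 := him (-1)
      norm_num at h1 h2
      simp
      linarith
  have h1 : b + c = 0 := key _ fun τ => by
    have := h τ
    simp only [Complex.star_def, Complex.conj_ofReal] at this
    convert this using 1
    ring
  have h2 : Complex.I * (b - c) = 0 := key _ fun τ => by
    have := h (τ * Complex.I)
    simp only [Complex.star_def, map_mul, Complex.conj_ofReal, Complex.conj_I] at this
    convert this using 1
    ring_nf
    rw [Complex.I_sq]
    ring
  have h3 : b - c = 0 := by simpa using h2
  linear_combination (h1 - h3) / 2

variable {d μ : ℕ}

lemma IsConvexInX.exists_symmetric_mem_support {p : NCPoly d d μ} (hp : IsConvexInX p)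
    {a b c : List (Fin μ ⊕ Fin μ)} {i j : Fin μ}
    (h : p (FreeMonoid.ofList (a ++ Sum.inl i :: (b ++ Sum.inl j :: c))) ≠ 0) :
    ∃ b', p (FreeMonoid.ofList (c.reverse ++ Sum.inl j :: (b' ++ Sum.inl j :: c))) ≠ 0 := by
  by_contra! hcon
  apply h
  ext s t
  rw [Matrix.zero_apply]
  by_cases hsupp : FreeMonoid.ofList (a ++ Sum.inl i :: (b ++ Sum.inl j :: c)) ∈ p.support
  swap
  · rw [Finsupp.notMem_support_iff.1 hsupp, Matrix.zero_apply]
  set L := p.support.sup fun w => w.toList.length with hL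
  obtain ⟨S, o, Ψ, hS, hΨ⟩ := exists_hermitian_dual_words (Fin μ ⊕ Fin μ) L
  set φ₁ : Fin d → Fin μ ⊕ Fin μ → List (Fin μ ⊕ Fin μ) → BoundedWord (Fin μ ⊕ Fin μ) L → ℂ :=
    fun t' z u => if t' = t ∧ z = Sum.inl j ∧ u = c then Pi.single o 1 else 0 with hφ₁
  set φ₂ : Fin d → Fin μ ⊕ Fin μ → List (Fin μ ⊕ Fin μ) → BoundedWord (Fin μ ⊕ Fin μ) L → ℂ :=
    fun s' z u => if s' = s ∧ z = Sum.inl i ∧ u = a.reverse then star (Ψ b) else 0 with hφ₂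
  have hφ₁' : ∀ t' z u, φ₁ t' z u ≠ 0 → t' = t ∧ z = Sum.inl j ∧ u = c := by
    intro t' z u hne
    by_contra hcon
    exact hne (if_neg hcon)
  have hφ₂' : ∀ s' z u, φ₂ s' z u ≠ 0 → s' = s ∧ z = Sum.inl i ∧ u = a.reverse := by
    intro t' z u hne
    by_contra hcon
    exact hne (if_neg hcon)
  have hφ₁y : ∀ t' k u, φ₁ t' (Sum.inr k) u = 0 := fun t' k u => by simp [hφ₁]
  have hφ₂y : ∀ t' k u, φ₂ t' (Sum.inr k) u = 0 := fun t' k u => by simp [hφ₂]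
  have hA : ∑ w ∈ p.support, ∑ s', ∑ t', p w s' t' *
      secondTerm S (φ₁ s') (φ₁ t') [] w.toList = 0 := by
    refine Finset.sum_eq_zero fun w hw => Finset.sum_eq_zero fun s' _ =>
      Finset.sum_eq_zero fun t' _ => ?_
    rw [secondTerm_eq_zero, mul_zero]
    intro r z b' z' c' hw'
    by_contra! hne
    obtain ⟨-, hz, hr⟩ := hφ₁' _ _ _ hne.1
    obtain ⟨-, hz', hc⟩ := hφ₁' _ _ _ hne.2
    rw [List.append_nil] at hr
    rw [hz, hz', hc, ← List.reverse_reverse r, hr] at hw'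
    exact Finsupp.mem_support_iff.1 hw (by rw [← hcon b', ← hw', FreeMonoid.ofList_toList])
  have hC : ∑ w ∈ p.support, ∑ s', ∑ t', p w s' t' *
      secondTerm S (φ₂ s') (φ₁ t') [] w.toList =
      p (FreeMonoid.ofList (a ++ Sum.inl i :: (b ++ Sum.inl j :: c))) s t := by
    have hlen : ∀ w ∈ p.support, w.toList.length ≤ L := fun w hw =>
      Finset.le_sup (f := fun w : FreeWord μ => w.toList.length) hw
    have hzero : ∀ w ∈ p.support, ∀ s' t', ¬ (w = FreeMonoid.ofList
        (a ++ Sum.inl i :: (b ++ Sum.inl j :: c)) ∧ s' = s ∧ t' = t) →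
        secondTerm S (φ₂ s') (φ₁ t') [] w.toList = 0 := by
      intro w hw s' t' hne
      by_cases hform : ∃ b', w.toList = a ++ Sum.inl i :: (b' ++ Sum.inl j :: c)
      · obtain ⟨b', hb'⟩ := hform
        have hlenw := hlen w hw
        rw [hb'] at hlenw ⊢
        rw [secondTerm_append_of_single (u₀ := a.reverse) (fun z u h => (hφ₂' _ _ _ h).2.2) a []
          _ (by simp), firstTerm_append_of_single (fun z u h => (hφ₁' _ _ _ h).2.2)]
        by_cases hs : s' = s
        · by_cases ht : t' = t
          · have hbb : b ≠ b' := by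
              rintro rfl
              exact hne ⟨by rw [← hb', FreeMonoid.ofList_toList], hs, ht⟩
            have hbL : b.length ≤ L := by
              have := hlen _ hsupp
              simp at this
              omega
            have hbL' : b'.length ≤ L := by
              simp at hlenw
              omega
            have := hΨ b b' hbL hbL'
            rw [if_neg hbb] at this
            simpa [hφ₂, hφ₁, hs, ht, dotProduct] using this
          · simp [hφ₁, ht]
        · simp [hφ₂, hs]
      · refine secondTerm_eq_zero fun r z b' z' c' hw' => ?_
        by_contra! hne
        obtain ⟨-, hz, hr⟩ := hφ₂' _ _ _ hne.1
        obtain ⟨-, hz', hc⟩ := hφ₁' _ _ _ hne.2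
        rw [List.append_nil, List.reverse_inj] at hr
        exact hform ⟨b', by rw [hw', hz, hz', hr, hc]⟩
    rw [Finset.sum_eq_single_of_mem _ hsupp, Finset.sum_eq_single s, Finset.sum_eq_single t]
    · have hbL : b.length ≤ L := by
        have := hlen _ hsupp
        simp at this
        omega
      rw [FreeMonoid.toList_ofList, secondTerm_append_of_single (u₀ := a.reverse)
        (fun z u h => (hφ₂' _ _ _ h).2.2) a [] _ (by simp),
        firstTerm_append_of_single (fun z u h => (hφ₁' _ _ _ h).2.2)]
      have := hΨ b b hbL hbL
      rw [if_pos rfl] at this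
      have h1 : star (φ₂ s (Sum.inl i) a.reverse) ⬝ᵥ
          (b.map S).prod *ᵥ φ₁ t (Sum.inl j) c = 1 := by
        simpa [hφ₂, hφ₁, dotProduct] using this
      rw [h1, mul_one]
    · intro t' _ ht
      rw [hzero _ hsupp _ _ fun h => ht h.2.2, mul_zero]
    · simp
    · intro s' _ hs
      exact Finset.sum_eq_zero fun t' _ => by
        rw [hzero _ hsupp _ _ fun h => hs h.2.1, mul_zero]
    · simp
    · intro w hw hne
      exact Finset.sum_eq_zero fun s' _ => Finset.sum_eq_zero fun t' _ => by
        rw [hzero _ hw _ _ fun h => hne h.1, mul_zero]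
  rw [← hC]
  apply eq_zero_of_sesquilinear_nonneg
    (b := ∑ w ∈ p.support, ∑ s', ∑ t', p w s' t' *
      secondTerm S (φ₁ s') (φ₂ t') [] w.toList)
    (e := ∑ w ∈ p.support, ∑ s', ∑ t', p w s' t' *
      secondTerm S (φ₂ s') (φ₂ t') [] w.toList)
  intro ζ
  have h := hp.secondTerm_nonneg S hS (fun t' => φ₁ t' + ζ • φ₂ t')
    (fun t' k u => by simp [hφ₁y, hφ₂y])
  convert h using 1
  rw [← zero_add (ζ * _), ← hA]
  simp only [Finset.mul_sum, ← Finset.sum_add_distrib]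
  refine Finset.sum_congr rfl fun w _ => Finset.sum_congr rfl fun s' _ =>
    Finset.sum_congr rfl fun t' _ => ?_
  simp only [secondTerm_add_left, secondTerm_add_right, secondTerm_smul_left,
    secondTerm_smul_right]
  ring

lemma exists_first_inl {w : List (Fin μ ⊕ Fin μ)} (h : 0 < xCount w) :
    ∃ a i w', w = a ++ Sum.inl i :: w' ∧ xCount a = 0 := by
  induction w with
  | nil => simp at h
  | cons z w ih =>
    rcases z with i | i
    · exact ⟨[], i, w, rfl, rfl⟩
    · obtain ⟨a, j, w', rfl, ha⟩ := ih (by simpa using h)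
      exact ⟨Sum.inr i :: a, j, w', rfl, by simpa using ha⟩

lemma exists_two_inl {w : List (Fin μ ⊕ Fin μ)} (h : 2 ≤ xCount w) :
    ∃ a i b j c, w = a ++ Sum.inl i :: (b ++ Sum.inl j :: c) ∧ xCount a = 0 ∧ xCount b = 0 := by
  obtain ⟨a, i, w', rfl, ha⟩ := exists_first_inl (w := w) (by omega)
  obtain ⟨b, j, c, rfl, hb⟩ := exists_first_inl (w := w') (by simp [ha] at h; omega)
  exact ⟨a, i, b, j, c, rfl, ha, hb⟩

lemma IsConvexInX.xCount_le_two {p : NCPoly d d μ} (hp : IsConvexInX p) {w : FreeWord μ}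
    (hw : p w ≠ 0) : xCount w.toList ≤ 2 := by
  obtain ⟨v, hv, hmax⟩ := p.support.exists_max_image (fun w => xCount w.toList)
    ⟨w, Finsupp.mem_support_iff.2 hw⟩
  refine (hmax w (Finsupp.mem_support_iff.2 hw)).trans ?_
  by_contra! hlt
  obtain ⟨a, i, b, j, c, hv', ha, hb⟩ := exists_two_inl hlt.le
  have hpv : p (FreeMonoid.ofList (a ++ Sum.inl i :: (b ++ Sum.inl j :: c))) ≠ 0 := by
    rw [← hv', FreeMonoid.ofList_toList]
    exact Finsupp.mem_support_iff.1 hv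
  obtain ⟨b', hb'⟩ := hp.exists_symmetric_mem_support hpv
  have h := hmax _ (Finsupp.mem_support_iff.2 hb')
  rw [FreeMonoid.toList_ofList, hv'] at h
  rw [hv'] at hlt
  simp only [xCount_append, xCount_cons_inl, xCount_reverse, ha, hb] at h hlt
  omega

end Support

section Swap

variable {N d μ : ℕ}

/-- Exchanging the letters `x_i` and `y_i` in a word. -/
def swapWord : FreeWord μ ≃ FreeWord μ where
  toFun w := FreeMonoid.ofList (w.toList.map Sum.swap)
  invFun w := FreeMonoid.ofList (w.toList.map Sum.swap)
  left_inv w := by simp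
  right_inv w := by simp

/-- Exchanging the roles of `x` and `y` in a polynomial. -/
noncomputable def swapPoly (p : NCPoly N d μ) : NCPoly N d μ := p.equivMapDomain swapWord

lemma swapPoly_apply_ofList (p : NCPoly N d μ) (w : List (Fin μ ⊕ Fin μ)) :
    swapPoly p (FreeMonoid.ofList w) = p (FreeMonoid.ofList (w.map Sum.swap)) := rfl

lemma polyEval_swapPoly {k : Type*} [Fintype k] [DecidableEq k] (p : NCPoly N d μ)
    (X Y : Fin μ → Matrix k k ℂ) : polyEval (swapPoly p) X Y = polyEval p Y X := by
  have hword : ∀ w, wordEval X Y (swapWord w) = wordEval Y X w := by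
    intro w
    rw [swapWord, Equiv.coe_fn_mk, wordEval_ofList, wordEval, List.map_map]
    congr 2
    funext z
    rcases z with i | i <;> rfl
  ext i j
  rw [polyEval_apply, polyEval_apply, swapPoly, Finsupp.sum_equivMapDomain]
  simp only [hword]

lemma IsConvexInY.isConvexInX_swapPoly {p : NCPoly d d μ} (hp : IsConvexInY p) :
    IsConvexInX (swapPoly p) := by
  intro n X₁ X₂ Y hX₁ hX₂ hY t ht₀ ht₁
  simp only [polyEval_swapPoly]
  exact hp n Y X₁ X₂ hY hX₁ hX₂ t ht₀ ht₁

lemma xCount_map_swap (w : List (Fin μ ⊕ Fin μ)) : xCount (w.map Sum.swap) = yCount w := by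
  induction w with
  | nil => rfl
  | cons z w ih => rcases z with i | i <;> simp [ih]

lemma yCount_map_swap (w : List (Fin μ ⊕ Fin μ)) : yCount (w.map Sum.swap) = xCount w := by
  induction w with
  | nil => rfl
  | cons z w ih => rcases z with i | i <;> simp [ih]

end Swap

section Border

/-- Indices of the border vector, whose entries are the words `x_i`, `y_i`, `x_i y_k` and
`y_i x_k`. -/
abbrev Border (μ : ℕ) := (Fin μ ⊕ Fin μ) ⊕ (Fin μ × Fin μ) ⊕ (Fin μ × Fin μ)

variable {d μ : ℕ}

def borderWord : Border μ → List (Fin μ ⊕ Fin μ)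
  | Sum.inl z => [z]
  | Sum.inr (Sum.inl (i, k)) => [Sum.inl i, Sum.inr k]
  | Sum.inr (Sum.inr (i, k)) => [Sum.inr i, Sum.inl k]

def borderSwap : Border μ → Border μ := Sum.map Sum.swap Sum.swap

/-- The words appearing in the product of the adjoint of the border vector with itself. -/
def borderProd (α β : Border μ) : List (Fin μ ⊕ Fin μ) := (borderWord α).reverse ++ borderWord β

lemma borderWord_borderSwap (α : Border μ) :
    borderWord (borderSwap α) = (borderWord α).map Sum.swap := by
  rcases α with (i | i) | ⟨i, k⟩ | ⟨i, k⟩ <;> rfl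

lemma borderSwap_borderSwap (α : Border μ) : borderSwap (borderSwap α) = α := by
  rcases α with (i | i) | ⟨i, k⟩ | ⟨i, k⟩ <;> rfl

lemma borderProd_borderSwap (α β : Border μ) :
    borderProd (borderSwap α) (borderSwap β) = (borderProd α β).map Sum.swap := by
  simp [borderProd, borderWord_borderSwap]

lemma borderProd_reverse (α β : Border μ) : (borderProd α β).reverse = borderProd β α := by
  simp [borderProd]

lemma eq_nil_or_singleton {u : List (Fin μ ⊕ Fin μ)} (hx : xCount u = 0) (hy : yCount u ≤ 1) :
    u = [] ∨ ∃ k, u = [Sum.inr k] := by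
  rcases u with _ | ⟨a | a, _ | ⟨b | b, u⟩⟩ <;> simp at hx hy ⊢

lemma IsConvexInX.exists_borderProd {p : NCPoly d d μ} (hp : IsConvexInX p)
    (hsym : ∀ w, p (FreeMonoid.ofList w) ≠ 0 → p (FreeMonoid.ofList w.reverse) ≠ 0)
    (hy : ∀ w, p (FreeMonoid.ofList w) ≠ 0 → yCount w ≤ 2)
    {w : List (Fin μ ⊕ Fin μ)} (hw : p (FreeMonoid.ofList w) ≠ 0) (hx : xCount w = 2) :
    ∃ α β, w = borderProd α β := by
  obtain ⟨a, i, b, j, c, rfl, ha, hb⟩ := exists_two_inl hx.ge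
  have hc : xCount c = 0 := by
    simp [ha, hb] at hx
    simp [hx]
  have hc1 : yCount c ≤ 1 := by
    obtain ⟨b', hb'⟩ := hp.exists_symmetric_mem_support hw
    have := hy _ hb'
    simp at this
    omega
  have ha1 : yCount a ≤ 1 := by
    have hw' := hsym _ hw
    have hrev : (a ++ Sum.inl i :: (b ++ Sum.inl j :: c)).reverse =
        c.reverse ++ Sum.inl j :: (b.reverse ++ Sum.inl i :: a.reverse) := by simp
    rw [hrev] at hw'
    obtain ⟨b', hb'⟩ := hp.exists_symmetric_mem_support hw'
    have := hy _ hb'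
    simp at this
    omega
  have hsum := hy _ hw
  simp only [yCount_append, yCount_cons_inl] at hsum
  have hb2 : b = [] ∨ (∃ k, b = [Sum.inr k]) ∨ ∃ k l, b = [Sum.inr k, Sum.inr l] := by
    rcases b with _ | ⟨k | k, _ | ⟨l | l, _ | ⟨m | m, b⟩⟩⟩ <;> simp at hb hsum ⊢
    omega
  rcases eq_nil_or_singleton ha ha1 with rfl | ⟨k, rfl⟩ <;>
  rcases eq_nil_or_singleton hc hc1 with rfl | ⟨l, rfl⟩ <;>
  rcases hb2 with rfl | ⟨k', rfl⟩ | ⟨k', l', rfl⟩ <;> simp at hsum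
  · exact ⟨Sum.inl (Sum.inl i), Sum.inl (Sum.inl j), rfl⟩
  · exact ⟨Sum.inl (Sum.inl i), Sum.inr (Sum.inr (k', j)), rfl⟩
  · exact ⟨Sum.inr (Sum.inr (k', i)), Sum.inr (Sum.inr (l', j)), rfl⟩
  · exact ⟨Sum.inl (Sum.inl i), Sum.inr (Sum.inl (j, l)), rfl⟩
  · exact ⟨Sum.inr (Sum.inr (k', i)), Sum.inr (Sum.inl (j, l)), rfl⟩
  · exact ⟨Sum.inr (Sum.inl (i, k)), Sum.inl (Sum.inl j), rfl⟩
  · exact ⟨Sum.inr (Sum.inl (i, k)), Sum.inr (Sum.inr (k', j)), rfl⟩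
  · exact ⟨Sum.inr (Sum.inl (i, k)), Sum.inr (Sum.inl (j, l)), rfl⟩

/-- The nonzero coefficients of `p` sit at pencil words and at the border products. -/
def HasBorderSupport (p : NCPoly d d μ) : Prop :=
  ∀ w, p (FreeMonoid.ofList w) ≠ 0 →
    (xCount w ≤ 1 ∧ yCount w ≤ 1) ∨ ∃ α β, w = borderProd α β

lemma HasBorderSupport.swapPoly {p : NCPoly d d μ} (hp : HasBorderSupport p) :
    HasBorderSupport (swapPoly p) := by
  intro w hw
  rw [swapPoly_apply_ofList] at hw
  rcases hp _ hw with ⟨hx, hy⟩ | ⟨α, β, h⟩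
  · exact Or.inl ⟨by rwa [yCount_map_swap] at hy, by rwa [xCount_map_swap] at hx⟩
  · refine Or.inr ⟨borderSwap α, borderSwap β, ?_⟩
    rw [borderProd_borderSwap, ← h]
    simp

lemma hasBorderSupport {p : NCPoly d d μ} (hherm : polyStar p = p) (hpx : IsConvexInX p)
    (hpy : IsConvexInY p) : HasBorderSupport p := by
  have hsym : ∀ w, p (FreeMonoid.ofList w) ≠ 0 → p (FreeMonoid.ofList w.reverse) ≠ 0 := by
    intro w hw h0
    rw [← hherm, polyStar_apply] at hw
    simp [h0] at hw
  have hx2 : ∀ w, p (FreeMonoid.ofList w) ≠ 0 → xCount w ≤ 2 := fun w hw => hpx.xCount_le_two hw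
  have hpy' := hpy.isConvexInX_swapPoly
  have hswap : ∀ w, p (FreeMonoid.ofList w) ≠ 0 →
      swapPoly p (FreeMonoid.ofList (w.map Sum.swap)) ≠ 0 := by
    intro w hw
    rw [swapPoly_apply_ofList]
    simpa using hw
  have hy2 : ∀ w, p (FreeMonoid.ofList w) ≠ 0 → yCount w ≤ 2 := by
    intro w hw
    rw [← xCount_map_swap]
    exact hpy'.xCount_le_two (hswap w hw)
  intro w hw
  by_cases hx : xCount w = 2
  · exact Or.inr (hpx.exists_borderProd hsym hy2 hw hx)
  by_cases hy : yCount w = 2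
  · obtain ⟨α, β, h⟩ := hpy'.exists_borderProd
      (fun w hw => by
        rw [swapPoly_apply_ofList, List.map_reverse]
        exact hsym _ hw)
      (fun w hw => by
        rw [← xCount_map_swap]
        exact hx2 _ hw) (hswap w hw) (by rw [xCount_map_swap, hy])
    refine Or.inr ⟨borderSwap α, borderSwap β, ?_⟩
    rw [borderProd_borderSwap, ← h]
    simp
  · have := hx2 w hw
    have := hy2 w hw
    exact Or.inl ⟨by omega, by omega⟩

end Border

section BorderWeight

variable {d μ : ℕ}

/-- Weights distributing the coefficient of a word evenly over the pairs of border words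
producing it; pencil words receive weight zero. -/
noncomputable def borderWeight : Border μ → Border μ → ℂ
  | Sum.inl (Sum.inl _), Sum.inl (Sum.inr _) => 0
  | Sum.inl (Sum.inr _), Sum.inl (Sum.inl _) => 0
  | Sum.inl (Sum.inl _), Sum.inr (Sum.inr _) => 1 / 2
  | Sum.inr (Sum.inr _), Sum.inl (Sum.inl _) => 1 / 2
  | Sum.inl (Sum.inr _), Sum.inr (Sum.inl _) => 1 / 2
  | Sum.inr (Sum.inl _), Sum.inl (Sum.inr _) => 1 / 2
  | _, _ => 1

lemma borderWeight_comm (α β : Border μ) : borderWeight α β = borderWeight β α := by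
  rcases α with (i | i) | ⟨i, k⟩ | ⟨i, k⟩ <;> rcases β with (j | j) | ⟨j, l⟩ | ⟨j, l⟩ <;> rfl

lemma star_borderWeight (α β : Border μ) : star (borderWeight α β) = borderWeight α β := by
  rcases α with (i | i) | ⟨i, k⟩ | ⟨i, k⟩ <;> rcases β with (j | j) | ⟨j, l⟩ | ⟨j, l⟩ <;>
    simp [borderWeight]

lemma borderWeight_borderSwap (α β : Border μ) :
    borderWeight (borderSwap α) (borderSwap β) = borderWeight α β := by
  rcases α with (i | i) | ⟨i, k⟩ | ⟨i, k⟩ <;> rcases β with (j | j) | ⟨j, l⟩ | ⟨j, l⟩ <;> rfl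

set_option maxHeartbeats 2000000 in
lemma sum_borderWeight_fiber (α₀ β₀ : Border μ)
    (h : ¬ (xCount (borderProd α₀ β₀) ≤ 1 ∧ yCount (borderProd α₀ β₀) ≤ 1)) :
    ∑ α, ∑ β, (if borderProd α β = borderProd α₀ β₀ then borderWeight α β else 0) = 1 := by
  rcases α₀ with (i | i) | ⟨i, k⟩ | ⟨i, k⟩ <;> rcases β₀ with (j | j) | ⟨j, l⟩ | ⟨j, l⟩ <;>
    simp [borderProd, borderWord] at h <;>
    simp [borderProd, borderWord, borderWeight, Fintype.sum_sum_type, Fintype.sum_prod_type,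
      ite_and, -Finset.sum_boole] <;> norm_num

lemma sum_support_eq_sum_border {p : NCPoly d d μ} (hsupp : HasBorderSupport p)
    (f : FreeWord μ → ℂ) (hf₀ : ∀ w, p w = 0 → f w = 0)
    (hf₁ : ∀ w : FreeWord μ, xCount w.toList ≤ 1 ∧ yCount w.toList ≤ 1 → f w = 0) :
    ∑ w ∈ p.support, f w =
      ∑ α, ∑ β, borderWeight α β * f (FreeMonoid.ofList (borderProd α β)) := by
  have hw : ∀ w ∈ p.support, f w = ∑ α, ∑ β,
      if borderProd α β = w.toList then borderWeight α β * f w else 0 := by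
    intro w hw
    by_cases hpen : xCount w.toList ≤ 1 ∧ yCount w.toList ≤ 1
    · simp [hf₁ w hpen]
    · obtain ⟨α₀, β₀, h⟩ := (hsupp w.toList (Finsupp.mem_support_iff.1 hw)).resolve_left hpen
      rw [h] at hpen ⊢
      conv_lhs => rw [← one_mul (f w), ← sum_borderWeight_fiber α₀ β₀ hpen]
      simp only [Finset.sum_mul, ite_mul, zero_mul]
  rw [Finset.sum_congr rfl hw, Finset.sum_comm]
  refine Finset.sum_congr rfl fun α _ => ?_
  rw [Finset.sum_comm]
  refine Finset.sum_congr rfl fun β _ => ?_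
  by_cases hmem : FreeMonoid.ofList (borderProd α β) ∈ p.support
  · rw [Finset.sum_eq_single_of_mem _ hmem]
    · simp
    · intro w _ hne
      rw [if_neg]
      intro heq
      exact hne (by rw [heq, FreeMonoid.ofList_toList])
  · rw [hf₀ _ (Finsupp.notMem_support_iff.1 hmem), mul_zero]
    refine Finset.sum_eq_zero fun w hw' => if_neg ?_
    intro heq
    rw [heq, FreeMonoid.ofList_toList] at hmem
    exact hmem hw'

variable {m : Type*} [Fintype m]

/-- The variation assigning border vectors to the words `x_j` and `x_j y_k`. -/
def borderTerm (v : Border μ × Fin d → m → ℂ) :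
    Fin d → Fin μ ⊕ Fin μ → List (Fin μ ⊕ Fin μ) → m → ℂ
  | t, Sum.inl j, [] => v (Sum.inl (Sum.inl j), t)
  | t, Sum.inl j, [Sum.inr k] => v (Sum.inr (Sum.inl (j, k)), t)
  | _, _, _ => 0

lemma secondTerm_borderTerm_of_xCount_le_one (v : Border μ × Fin d → m → ℂ)
    (Z : Fin μ ⊕ Fin μ → Matrix m m ℂ) (s t : Fin d) {w : List (Fin μ ⊕ Fin μ)}
    (hw : xCount w ≤ 1) : secondTerm Z (borderTerm v s) (borderTerm v t) [] w = 0 := by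
  refine secondTerm_eq_zero fun r z b z' c h => ?_
  rcases z with i | i
  · rcases z' with j | j
    · rw [h] at hw
      simp at hw
      omega
    · exact Or.inr (by simp [borderTerm])
  · exact Or.inl (by simp [borderTerm])

lemma secondTerm_borderProd (v : Border μ × Fin d → m → ℂ) (Y : Fin μ → Matrix m m ℂ)
    (hY : ∀ k, (Y k).IsHermitian)
    (hYv : ∀ k j t, Y k *ᵥ v (Sum.inl (Sum.inl j), t) = v (Sum.inr (Sum.inr (k, j)), t))
    (hv : ∀ i t, v (Sum.inl (Sum.inr i), t) = 0) (α β : Border μ) (s t : Fin d) :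
    secondTerm (Sum.elim 0 Y) (borderTerm v s) (borderTerm v t) [] (borderProd α β) =
      star (v (α, s)) ⬝ᵥ v (β, t) := by
  have hYv' : ∀ k j t u, star (v (Sum.inl (Sum.inl j), t)) ⬝ᵥ Y k *ᵥ u =
      star (v (Sum.inr (Sum.inr (k, j)), t)) ⬝ᵥ u := by
    intro k j t u
    rw [← hYv, Matrix.star_mulVec, (hY k).eq, Matrix.dotProduct_mulVec]
  rcases α with (i | i) | ⟨i, k⟩ | ⟨i, k⟩ <;> rcases β with (j | j) | ⟨j, l⟩ | ⟨j, l⟩ <;>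
    simp [borderProd, borderWord, secondTerm, firstTerm, borderTerm, hv, hYv, hYv']
  rw [← hYv', hYv]

lemma IsConvexInX.border_nonneg [DecidableEq m] {p : NCPoly d d μ} (hp : IsConvexInX p)
    (hsupp : HasBorderSupport p) (v : Border μ × Fin d → m → ℂ) (Y : Fin μ → Matrix m m ℂ)
    (hY : ∀ k, (Y k).IsHermitian)
    (hYv : ∀ k j t, Y k *ᵥ v (Sum.inl (Sum.inl j), t) = v (Sum.inr (Sum.inr (k, j)), t))
    (hv : ∀ i t, v (Sum.inl (Sum.inr i), t) = 0) :
    0 ≤ ∑ α, ∑ β, borderWeight α β * ∑ s, ∑ t, p (FreeMonoid.ofList (borderProd α β)) s t *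
      (star (v (α, s)) ⬝ᵥ v (β, t)) := by
  have h := hp.secondTerm_nonneg (Sum.elim 0 Y)
    (by
      rintro (i | i)
      · exact Matrix.isHermitian_zero
      · exact hY i) (borderTerm v) (fun t k w => by simp [borderTerm])
  rw [sum_support_eq_sum_border hsupp (fun w => ∑ s, ∑ t, p w s t *
    secondTerm (Sum.elim 0 Y) (borderTerm v s) (borderTerm v t) [] w.toList)] at h
  · simpa only [FreeMonoid.toList_ofList, secondTerm_borderProd v Y hY hYv hv] using h
  · intro w hw
    simp [hw]
  · intro w hw
    simp [secondTerm_borderTerm_of_xCount_le_one v _ _ _ hw.1]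

/-- A hermitian matrix with prescribed symmetric action on linearly independent columns. -/
lemma exists_hermitian_mul_eq {n : Type*} [Fintype n] [DecidableEq n] (F G : Matrix m n ℂ)
    (E : Matrix n m ℂ) (hEF : E * F = 1) (hFG : Fᴴ * G = Gᴴ * F) :
    ∃ Y : Matrix m m ℂ, Y.IsHermitian ∧ Y * F = G := by
  have hEF' : Fᴴ * Eᴴ = 1 := by
    rw [← Matrix.conjTranspose_mul, hEF, Matrix.conjTranspose_one]
  refine ⟨G * E + Eᴴ * Gᴴ - Eᴴ * (Fᴴ * G) * E, ?_, ?_⟩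
  · rw [Matrix.IsHermitian]
    simp only [Matrix.conjTranspose_add, Matrix.conjTranspose_sub, Matrix.conjTranspose_mul,
      Matrix.conjTranspose_conjTranspose, Matrix.mul_assoc]
    rw [← Matrix.mul_assoc Gᴴ F, ← hFG, Matrix.mul_assoc, add_comm (Eᴴ * Gᴴ)]
  · rw [Matrix.sub_mul, Matrix.add_mul, Matrix.mul_assoc G, Matrix.mul_assoc _ E F, hEF,
      Matrix.mul_one, Matrix.mul_one, Matrix.mul_assoc, hFG]
    abel

end BorderWeight

section Separation

variable {J : Type*} [Fintype J]

/-- The bilinear entrywise pairing of square matrices. -/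
noncomputable def entryPairing (A S : Matrix J J ℂ) : ℂ := ∑ i, ∑ j, A i j * S i j

lemma entryPairing_add (A S T : Matrix J J ℂ) :
    entryPairing A (S + T) = entryPairing A S + entryPairing A T := by
  simp [entryPairing, mul_add, Finset.sum_add_distrib]

lemma add_entryPairing (A B S : Matrix J J ℂ) :
    entryPairing (A + B) S = entryPairing A S + entryPairing B S := by
  simp [entryPairing, add_mul, Finset.sum_add_distrib]

lemma smul_entryPairing (c : ℂ) (A S : Matrix J J ℂ) :
    entryPairing (c • A) S = c * entryPairing A S := by
  simp [entryPairing, mul_assoc, Finset.mul_sum]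

lemma neg_entryPairing (A S : Matrix J J ℂ) : entryPairing (-A) S = -entryPairing A S := by
  simp [entryPairing]

lemma one_entryPairing [DecidableEq J] (S : Matrix J J ℂ) : entryPairing 1 S = S.trace := by
  simp [entryPairing, Matrix.one_apply, Matrix.trace]

lemma entryPairing_conjTranspose (A : Matrix J J ℂ) {S : Matrix J J ℂ} (hS : S.IsHermitian) :
    entryPairing Aᴴ S = star (entryPairing A S) := by
  simp only [entryPairing, star_sum, star_mul']
  rw [Finset.sum_comm]
  simp only [Matrix.conjTranspose_apply, hS.apply]

lemma entryPairing_vecMulVec (A : Matrix J J ℂ) (v : J → ℂ) :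
    entryPairing A (Matrix.vecMulVec (star v) v) = star v ⬝ᵥ A *ᵥ v := by
  simp only [entryPairing, Matrix.vecMulVec_apply, dotProduct, Matrix.mulVec, Finset.mul_sum]
  exact Finset.sum_congr rfl fun i _ => Finset.sum_congr rfl fun j _ => by ring

lemma exists_re_entryPairing_eq [DecidableEq J] (f : Matrix J J ℂ →ₗ[ℝ] ℝ) :
    ∃ A : Matrix J J ℂ, ∀ S, f S = (entryPairing A S).re := by
  refine ⟨Matrix.of fun i j => (f (Matrix.single i j 1) : ℂ) -
    Complex.I * (f (Matrix.single i j Complex.I) : ℂ), fun S => ?_⟩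
  conv_lhs => rw [Matrix.matrix_eq_sum_single S]
  simp only [map_sum, entryPairing, Complex.re_sum]
  refine Finset.sum_congr rfl fun i _ => Finset.sum_congr rfl fun j _ => ?_
  have h : Matrix.single i j (S i j) = (S i j).re • Matrix.single i j (1 : ℂ) +
      (S i j).im • Matrix.single i j Complex.I := by
    simp only [Matrix.smul_single, ← Matrix.single_add]
    congr 1
    rw [Complex.real_smul, Complex.real_smul, mul_one, Complex.re_add_im]
  rw [h, map_add, map_smul, map_smul]
  simp
  ring

lemma Matrix.PosSemidef.norm_apply_le_trace [DecidableEq J] {S : Matrix J J ℂ}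
    (hS : S.PosSemidef) (i j : J) : ‖S i j‖ ≤ S.trace.re := by
  have hdiag : ∀ k, (S k k).re ≤ S.trace.re := by
    intro k
    rw [Matrix.trace, Complex.re_sum]
    exact Finset.single_le_sum (f := fun k => (S k k).re)
      (fun k _ => (Complex.nonneg_iff.1 (hS.diag_nonneg (i := k))).1) (Finset.mem_univ k)
  obtain ⟨c, hc, hcS⟩ : ∃ c : ℂ, star c * c = 1 ∧ c * S i j = -(‖S i j‖ : ℂ) := by
    by_cases h : S i j = 0
    · exact ⟨1, by simp [h]⟩
    · have hn : (‖S i j‖ : ℂ) ≠ 0 := by simpa using h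
      have hsq : star (S i j) * S i j = (‖S i j‖ : ℂ) ^ 2 := Complex.conj_mul' _
      refine ⟨-star (S i j) / ‖S i j‖, ?_, ?_⟩
      · rw [star_div₀, star_neg, star_star]
        simp only [Complex.star_def, Complex.conj_ofReal] at hsq ⊢
        field_simp
        rw [← hsq]; ring
      · field_simp
        rw [hsq]
  have h := hS.dotProduct_mulVec_nonneg (Pi.single i 1 + c • Pi.single j 1)
  have hcS' : star c * S j i = -(‖S i j‖ : ℂ) := by
    rw [← hS.isHermitian.apply j i, ← star_mul', hcS]
    simp
  have hexp : star (Pi.single i 1 + c • Pi.single j 1 : J → ℂ) ⬝ᵥ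
      S *ᵥ (Pi.single i 1 + c • Pi.single j 1) =
      S i i + S j j - 2 * ‖S i j‖ := by
    have : star (Pi.single i 1 + c • Pi.single j 1 : J → ℂ) ⬝ᵥ
      S *ᵥ (Pi.single i 1 + c • Pi.single j 1) =
      S i i + c * S i j + star c * S j i + star c * c * S j j := by
      simp [Matrix.mulVec_add, Matrix.mulVec_smul, dotProduct_add, add_dotProduct, Pi.star_single]
      ring
    rw [this, hcS, hcS', hc]
    ring
  rw [hexp] at h
  have h' := (Complex.nonneg_iff.1 h).1
  simp at h'
  have := hdiag i
  have := hdiag j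
  linarith

lemma isClosed_setOf_posSemidef : IsClosed {S : Matrix J J ℂ | S.PosSemidef} := by
  simp only [Matrix.posSemidef_iff_dotProduct_mulVec, Set.ofPred_and, Set.ofPred_forall]
  refine IsClosed.inter ?_ (isClosed_iInter fun v => ?_)
  · exact isClosed_eq (by fun_prop) continuous_id
  · refine isClosed_le continuous_const ?_
    fun_prop

lemma isCompact_posSemidef_trace_le [DecidableEq J] (σ : ℝ) :
    IsCompact {S : Matrix J J ℂ | S.PosSemidef ∧ S.trace.re ≤ σ} := by
  have hK : IsCompact (Set.univ.pi fun _ : J => Set.univ.pi fun _ : J =>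
      Metric.closedBall (0 : ℂ) σ) :=
    isCompact_univ_pi fun _ => isCompact_univ_pi fun _ => isCompact_closedBall _ _
  refine IsCompact.of_isClosed_subset hK
    (isClosed_setOf_posSemidef.inter (isClosed_le
      (Complex.continuous_re.comp continuous_id.matrix_trace) continuous_const)) ?_
  rintro S ⟨hS, hσ⟩ i _ j _
  simpa using (hS.norm_apply_le_trace i j).trans hσ

/-- A hermitian matrix whose pairing with every positive definite matrix annihilating a space
`𝓡` of traceless hermitian matrices is nonnegative is positive semidefinite modulo `𝓡`. -/
lemma exists_add_posSemidef [DecidableEq J] (𝓡 : Submodule ℝ (Matrix J J ℂ))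
    (hherm : ∀ R ∈ 𝓡, R.IsHermitian) (htr : ∀ R ∈ 𝓡, R.trace = 0) {G : Matrix J J ℂ}
    (hG : G.IsHermitian)
    (h : ∀ T : Matrix J J ℂ, T.PosDef → (∀ R ∈ 𝓡, (entryPairing T R).re = 0) →
      0 ≤ (entryPairing T G).re) : ∃ R ∈ 𝓡, (G + R).PosSemidef := by
  by_contra! hcon
  have : LocallyConvexSpace ℝ (Matrix J J ℂ) :=
    inferInstanceAs (LocallyConvexSpace ℝ (J → J → ℂ))
  set σ : ℝ := |G.trace.re| + 1 with hσ
  have hσ₀ : 0 < σ := by positivity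
  have hconv : Convex ℝ {S : Matrix J J ℂ | S.PosSemidef ∧ S.trace.re ≤ σ} := by
    rintro S ⟨hS, hS'⟩ T ⟨hT, hT'⟩ a b ha hb hab
    refine ⟨(hS.smul ha).add (hT.smul hb), ?_⟩
    simp only [Matrix.trace_add, Matrix.trace_smul, Complex.add_re, Complex.smul_re, smul_eq_mul]
    calc a * S.trace.re + b * T.trace.re ≤ a * σ + b * σ := by gcongr
      _ = σ := by rw [← add_mul, hab, one_mul]
  have hclosed : IsClosed {S : Matrix J J ℂ | S - G ∈ 𝓡} :=
    (Submodule.closed_of_finiteDimensional 𝓡).preimage (continuous_id.sub continuous_const)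
  have hconv' : Convex ℝ {S : Matrix J J ℂ | S - G ∈ 𝓡} := by
    intro S hS T hT a b _ _ hab
    have : a • S + b • T - G = a • (S - G) + b • (T - G) := by
      conv_lhs => rw [← one_smul ℝ G, ← hab]
      module
    rw [Set.mem_ofPred_eq, this]
    exact 𝓡.add_mem (𝓡.smul_mem _ hS) (𝓡.smul_mem _ hT)
  have hdisj : Disjoint {S : Matrix J J ℂ | S.PosSemidef ∧ S.trace.re ≤ σ}
      {S : Matrix J J ℂ | S - G ∈ 𝓡} := by
    refine Set.disjoint_left.2 fun S hS hSG => hcon _ hSG ?_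
    rw [add_sub_cancel]
    exact hS.1
  obtain ⟨f, u, v, hu, huv, hv⟩ := geometric_hahn_banach_compact_closed hconv
    (isCompact_posSemidef_trace_le σ) hconv' hclosed hdisj
  have hu₀ : 0 < u := by
    simpa using hu 0 ⟨Matrix.PosSemidef.zero, by simpa using hσ₀.le⟩
  have hf : ∀ R ∈ 𝓡, f R = 0 := by
    intro R hR
    by_contra hne
    have := hv (G + ((v - f G) / f R) • R) (by
      simpa using 𝓡.smul_mem _ hR)
    rw [map_add, map_smul, smul_eq_mul, div_mul_cancel₀ _ hne] at this
    linarith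
  obtain ⟨A, hA⟩ := exists_re_entryPairing_eq (f : Matrix J J ℂ →ₗ[ℝ] ℝ)
  replace hA : ∀ S, f S = (entryPairing A S).re := hA
  set T : Matrix J J ℂ := ((u / σ : ℝ) : ℂ) • 1 + -((1 / 2 : ℂ) • (A + Aᴴ)) with hT
  have hTS : ∀ S : Matrix J J ℂ, S.IsHermitian →
      (entryPairing T S).re = u / σ * S.trace.re - f S := by
    intro S hS
    rw [hT, add_entryPairing, neg_entryPairing, smul_entryPairing, smul_entryPairing,
      add_entryPairing, one_entryPairing, entryPairing_conjTranspose A hS, hA]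
    simp
    ring
  have hTherm : T.IsHermitian := by
    simp only [Matrix.IsHermitian, hT, Matrix.conjTranspose_add, Matrix.conjTranspose_neg,
      Matrix.conjTranspose_smul, Matrix.conjTranspose_one, Matrix.conjTranspose_conjTranspose]
    simp [add_comm A]
  have hTpos : T.PosDef := by
    refine Matrix.PosDef.of_dotProduct_mulVec_pos hTherm fun w hw => ?_
    have hpsd : (Matrix.vecMulVec (star w) w).PosSemidef := by
      simpa using Matrix.posSemidef_vecMulVec_self_star (star w)
    have htrace : (Matrix.vecMulVec (star w) w).trace = star w ⬝ᵥ w := Matrix.trace_vecMulVec _ _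
    have hpos : 0 < star w ⬝ᵥ w := Matrix.dotProduct_star_self_pos_iff.2 hw
    obtain ⟨hpos_re, hpos_im⟩ := Complex.pos_iff.1 hpos
    have him : (star w ⬝ᵥ T *ᵥ w).im = 0 := hTherm.im_star_dotProduct_mulVec_self w
    rw [Complex.pos_iff]
    refine ⟨?_, him.symm⟩
    rw [← entryPairing_vecMulVec, hTS _ hpsd.isHermitian, htrace]
    have hmem := hu ((σ / (star w ⬝ᵥ w).re) • Matrix.vecMulVec (star w) w)
      ⟨hpsd.smul (by positivity), by
        rw [Matrix.trace_smul, htrace, Complex.smul_re, smul_eq_mul,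
          div_mul_cancel₀ _ hpos_re.ne']⟩
    rw [map_smul, smul_eq_mul, div_mul_eq_mul_div, div_lt_iff₀ hpos_re] at hmem
    rw [sub_pos, div_mul_eq_mul_div, lt_div_iff₀ hσ₀, mul_comm]
    exact hmem
  have hTG := h T hTpos fun R hR => by
    rw [hTS R (hherm R hR), htr R hR, hf R hR]
    simp
  rw [hTS G hG] at hTG
  have hfG : u < f G := huv.trans (hv G (by simp))
  have : u / σ * G.trace.re ≤ u := by
    rw [div_mul_eq_mul_div, div_le_iff₀ hσ₀]
    gcongr
    exact (le_abs_self _).trans (by linarith)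
  linarith

end Separation

section Gram

open scoped MatrixOrder in
lemma Matrix.PosSemidef.exists_eq_conjTranspose_mul_self {n : Type*} [Fintype n] [DecidableEq n]
    {A : Matrix n n ℂ} (hA : A.PosSemidef) : ∃ B : Matrix n n ℂ, A = Bᴴ * B :=
  CStarAlgebra.nonneg_iff_eq_star_mul_self.1 hA.nonneg

variable {d μ : ℕ} {m : Type*} [Fintype m] [DecidableEq m]

lemma IsConvexInX.border_nonneg_of_projection {p : NCPoly d d μ} (hp : IsConvexInX p)
    (hsupp : HasBorderSupport p) (v : Border μ × Fin d → m → ℂ)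
    (hpos : (Matrix.of fun a b : Fin μ × Fin d =>
      star (v (Sum.inl (Sum.inl a.1), a.2)) ⬝ᵥ v (Sum.inl (Sum.inl b.1), b.2)).PosDef)
    (hcomm : ∀ k i j s t, star (v (Sum.inl (Sum.inl i), s)) ⬝ᵥ v (Sum.inr (Sum.inr (k, j)), t) =
      star (v (Sum.inr (Sum.inr (k, i)), s)) ⬝ᵥ v (Sum.inl (Sum.inl j), t))
    {Q : Matrix m m ℂ} (hQ : Q.IsHermitian) (hQQ : Q * Q = Q)
    (hQx : ∀ i t, Q *ᵥ v (Sum.inl (Sum.inl i), t) = v (Sum.inl (Sum.inl i), t))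
    (hQy : ∀ i t, Q *ᵥ v (Sum.inl (Sum.inr i), t) = 0) :
    0 ≤ ∑ α, ∑ β, borderWeight α β * ∑ s, ∑ t, p (FreeMonoid.ofList (borderProd α β)) s t *
      (star (v (α, s)) ⬝ᵥ Q *ᵥ v (β, t)) := by
  have hQdot : ∀ a b : m → ℂ, star (Q *ᵥ a) ⬝ᵥ b = star a ⬝ᵥ Q *ᵥ b := by
    intro a b
    rw [Matrix.star_mulVec, hQ.eq, Matrix.dotProduct_mulVec]
  have hQdot' : ∀ a b : m → ℂ, star (Q *ᵥ a) ⬝ᵥ (Q *ᵥ b) = star a ⬝ᵥ Q *ᵥ b := by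
    intro a b
    rw [hQdot, Matrix.mulVec_mulVec, hQQ]
  set F : Matrix m (Fin μ × Fin d) ℂ :=
    Matrix.of fun a b => v (Sum.inl (Sum.inl b.1), b.2) a with hF
  let G : Fin μ → Matrix m (Fin μ × Fin d) ℂ := fun k =>
    Matrix.of fun a b => (Q *ᵥ v (Sum.inr (Sum.inr (k, b.1)), b.2)) a
  have hFF : (Fᴴ * F).PosDef := hpos
  have hY : ∀ k, ∃ Y : Matrix m m ℂ, Y.IsHermitian ∧ Y * F = G k := by
    intro k
    refine exists_hermitian_mul_eq F (G k) ((Fᴴ * F)⁻¹ * Fᴴ) ?_ ?_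
    · rw [Matrix.mul_assoc]
      exact Matrix.nonsing_inv_mul _ ((Matrix.isUnit_iff_isUnit_det _).1 hFF.isUnit)
    · ext ⟨i, s⟩ ⟨j, t⟩
      change star (v (Sum.inl (Sum.inl i), s)) ⬝ᵥ (Q *ᵥ v (Sum.inr (Sum.inr (k, j)), t)) =
        star (Q *ᵥ v (Sum.inr (Sum.inr (k, i)), s)) ⬝ᵥ v (Sum.inl (Sum.inl j), t)
      rw [← hQdot, hQx, hQdot, hQx, hcomm]
  choose Y hYh hYF using hY
  have h := hp.border_nonneg hsupp (fun a => Q *ᵥ v a) Y hYh (fun k j t => ?_) hQy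
  · simpa only [hQdot'] using h
  · rw [hQx]
    funext a
    exact congrFun (congrFun (hYF k) a) (j, t)

omit [DecidableEq m] in
lemma exists_projection {n : Type*} [Fintype n] [DecidableEq n] {F : Matrix m n ℂ}
    (hF : (Fᴴ * F).PosDef) : ∃ P : Matrix m m ℂ, P.IsHermitian ∧ P * P = P ∧ P * F = F ∧
      ∀ u, Fᴴ *ᵥ u = 0 → P *ᵥ u = 0 := by
  have hunit := (Matrix.isUnit_iff_isUnit_det _).1 hF.isUnit
  have hPF : F * (Fᴴ * F)⁻¹ * Fᴴ * F = F := by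
    rw [Matrix.mul_assoc, Matrix.mul_assoc, Matrix.nonsing_inv_mul _ hunit, Matrix.mul_one]
  refine ⟨F * (Fᴴ * F)⁻¹ * Fᴴ, ?_, ?_, hPF, ?_⟩
  · exact Matrix.isHermitian_mul_mul_conjTranspose F hF.isHermitian.inv
  · rw [← Matrix.mul_assoc, ← Matrix.mul_assoc, hPF]
  · intro u hu
    rw [← Matrix.mulVec_mulVec, hu, Matrix.mulVec_zero]

/-- Nonnegativity of the border form against positive definite matrices with the symmetries
of a Gram matrix of border vectors. -/
lemma border_nonneg_of_posDef {p : NCPoly d d μ} (hpx : IsConvexInX p) (hpy : IsConvexInY p)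
    (hsupp : HasBorderSupport p) {T : Matrix (Border μ × Fin d) (Border μ × Fin d) ℂ}
    (hT : T.PosDef)
    (hxy : ∀ i j s t, T (Sum.inl (Sum.inl i), s) (Sum.inl (Sum.inr j), t) = 0)
    (hx : ∀ k i j s t, T (Sum.inl (Sum.inl i), s) (Sum.inr (Sum.inr (k, j)), t) =
      T (Sum.inr (Sum.inr (k, i)), s) (Sum.inl (Sum.inl j), t))
    (hy : ∀ k i j s t, T (Sum.inl (Sum.inr i), s) (Sum.inr (Sum.inl (k, j)), t) =
      T (Sum.inr (Sum.inl (k, i)), s) (Sum.inl (Sum.inr j), t)) :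
    0 ≤ ∑ α, ∑ β, borderWeight α β * ∑ s, ∑ t, p (FreeMonoid.ofList (borderProd α β)) s t *
      T (α, s) (β, t) := by
  obtain ⟨V, rfl⟩ : ∃ V : Matrix (Border μ × Fin d) (Border μ × Fin d) ℂ, T = Vᴴ * V :=
    hT.posSemidef.exists_eq_conjTranspose_mul_self
  let v : Border μ × Fin d → Border μ × Fin d → ℂ := fun a => V.col a
  have hv : ∀ a b, (Vᴴ * V) a b = star (v a) ⬝ᵥ v b := fun a b => rfl
  simp only [hv] at hxy hx hy ⊢
  have hgram : ∀ z : Fin μ → Border μ, Function.Injective z →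
      (Matrix.of fun a b : Fin μ × Fin d => star (v (z a.1, a.2)) ⬝ᵥ v (z b.1, b.2)).PosDef :=
    fun z hz => hT.submatrix (e := Prod.map z id) (hz.prodMap Function.injective_id)
  have hgx := hgram (fun i => Sum.inl (Sum.inl i)) (fun i j h => by simpa using h)
  have hgy := hgram (fun i => Sum.inl (Sum.inr i)) (fun i j h => by simpa using h)
  obtain ⟨P, hP, hPP, hPF, hPu⟩ := exists_projection
    (F := Matrix.of fun a (b : Fin μ × Fin d) => v (Sum.inl (Sum.inl b.1), b.2) a) hgx
  have hPx : ∀ i t, P *ᵥ v (Sum.inl (Sum.inl i), t) = v (Sum.inl (Sum.inl i), t) := by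
    intro i t
    funext a
    exact congrFun (congrFun hPF a) (i, t)
  have hPy : ∀ i t, P *ᵥ v (Sum.inl (Sum.inr i), t) = 0 := by
    intro i t
    refine hPu _ ?_
    funext b
    exact hxy b.1 i b.2 t
  have h₁ := hpx.border_nonneg_of_projection hsupp v hgx hx hP hPP hPx hPy
  have h₂ := hpy.isConvexInX_swapPoly.border_nonneg_of_projection hsupp.swapPoly
    (fun a => v (borderSwap a.1, a.2)) hgy hy (Q := 1 - P)
    (Matrix.isHermitian_one.sub hP) (by simp [sub_mul, mul_sub, hPP])
    (fun i t => by
      change (1 - P) *ᵥ v (Sum.inl (Sum.inr i), t) = v (Sum.inl (Sum.inr i), t)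
      rw [Matrix.sub_mulVec, Matrix.one_mulVec, hPy, sub_zero])
    (fun i t => by
      change (1 - P) *ᵥ v (Sum.inl (Sum.inl i), t) = 0
      rw [Matrix.sub_mulVec, Matrix.one_mulVec, hPx, sub_self])
  let e : Border μ ≃ Border μ := ⟨borderSwap, borderSwap, borderSwap_borderSwap,
    borderSwap_borderSwap⟩
  have h₃ : 0 ≤ ∑ α, ∑ β, borderWeight α β * ∑ s, ∑ t,
      p (FreeMonoid.ofList (borderProd α β)) s t *
        (star (v (α, s)) ⬝ᵥ (1 - P) *ᵥ v (β, t)) := by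
    refine h₂.trans_eq (Eq.trans ?_ (e.sum_comp _))
    refine Finset.sum_congr rfl fun α _ => Eq.trans ?_ (e.sum_comp _)
    refine Finset.sum_congr rfl fun β _ => ?_
    change _ = borderWeight (borderSwap α) (borderSwap β) * ∑ s, ∑ t,
      p (FreeMonoid.ofList (borderProd (borderSwap α) (borderSwap β))) s t *
        (star (v (borderSwap α, s)) ⬝ᵥ (1 - P) *ᵥ v (borderSwap β, t))
    rw [borderWeight_borderSwap]
    simp only [borderProd_borderSwap, swapPoly_apply_ofList]
  refine (add_nonneg h₁ h₃).trans_eq ?_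
  simp only [← Finset.sum_add_distrib, ← mul_add, Matrix.sub_mulVec, Matrix.one_mulVec,
    dotProduct_sub, add_sub_cancel]

end Gram

section Certificate

variable {d μ : ℕ}

/-- The coefficient of `w` in the polynomial represented by `G` in the border vector. -/
noncomputable def borderCoeff (w : List (Fin μ ⊕ Fin μ)) :
    Matrix (Border μ × Fin d) (Border μ × Fin d) ℂ →ₗ[ℂ] Matrix (Fin d) (Fin d) ℂ where
  toFun G := Matrix.of fun s t => ∑ α, ∑ β,
    (if borderProd α β = w then 1 else 0) * G (α, s) (β, t)
  map_add' G H := by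
    ext s t
    simp only [Matrix.of_apply, Matrix.add_apply, mul_add, Finset.sum_add_distrib]
  map_smul' c G := by
    ext s t
    simp only [Matrix.of_apply, Matrix.smul_apply, RingHom.id_apply, smul_eq_mul,
      Finset.mul_sum, mul_left_comm c]

lemma borderCoeff_apply (w : List (Fin μ ⊕ Fin μ))
    (G : Matrix (Border μ × Fin d) (Border μ × Fin d) ℂ) (s t : Fin d) :
    borderCoeff w G s t = ∑ α, ∑ β, if borderProd α β = w then G (α, s) (β, t) else 0 := by
  simp [borderCoeff]

lemma borderCoeff_conjTranspose (w : List (Fin μ ⊕ Fin μ))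
    (G : Matrix (Border μ × Fin d) (Border μ × Fin d) ℂ) :
    borderCoeff w Gᴴ = (borderCoeff w.reverse G)ᴴ := by
  ext s t
  rw [Matrix.conjTranspose_apply, borderCoeff_apply, borderCoeff_apply, Finset.sum_comm]
  simp only [star_sum, apply_ite star, star_zero, Matrix.conjTranspose_apply]
  refine Finset.sum_congr rfl fun α _ => Finset.sum_congr rfl fun β _ => ?_
  simp only [← List.reverse_eq_iff, borderProd_reverse]

lemma borderCoeff_single (w : List (Fin μ ⊕ Fin μ)) (α β : Border μ) (s t : Fin d) (c : ℂ) :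
    borderCoeff w (Matrix.single (α, s) (β, t) c) =
      if borderProd α β = w then Matrix.single s t c else 0 := by
  ext s' t'
  rw [borderCoeff_apply, Finset.sum_eq_single α, Finset.sum_eq_single β]
  · split_ifs <;> simp [Matrix.single_apply]
  · intro β' _ hβ
    simp [hβ.symm]
  · simp
  · intro α' _ hα
    simp [hα.symm]
  · simp

/-- Traceless matrices representing a polynomial supported on pencil words. -/
noncomputable def borderKernel (d μ : ℕ) :
    Submodule ℂ (Matrix (Border μ × Fin d) (Border μ × Fin d) ℂ) where
  carrier := {R | R.trace = 0 ∧
    ∀ w, ¬ (xCount w ≤ 1 ∧ yCount w ≤ 1) → borderCoeff w R = 0}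
  zero_mem' := by simp
  add_mem' := by
    rintro R S ⟨hR, hR'⟩ ⟨hS, hS'⟩
    exact ⟨by simp [hR, hS], fun w hw => by rw [map_add, hR' w hw, hS' w hw, add_zero]⟩
  smul_mem' := by
    rintro c R ⟨hR, hR'⟩
    exact ⟨by simp [hR], fun w hw => by rw [map_smul, hR' w hw, smul_zero]⟩

lemma conjTranspose_mem_borderKernel {R : Matrix (Border μ × Fin d) (Border μ × Fin d) ℂ}
    (hR : R ∈ borderKernel d μ) : Rᴴ ∈ borderKernel d μ := by
  refine ⟨by rw [Matrix.trace_conjTranspose, hR.1, star_zero], fun w hw => ?_⟩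
  rw [borderCoeff_conjTranspose, hR.2 w.reverse (by simpa using hw), Matrix.conjTranspose_zero]

/-- The hermitian matrices of `borderKernel`. -/
noncomputable def hermitianBorderKernel (d μ : ℕ) :
    Submodule ℝ (Matrix (Border μ × Fin d) (Border μ × Fin d) ℂ) :=
  (borderKernel d μ).restrictScalars ℝ ⊓ selfAdjoint.submodule ℝ _

lemma entryPairing_eq_zero_of_mem_borderKernel
    {T : Matrix (Border μ × Fin d) (Border μ × Fin d) ℂ} (hT : T.IsHermitian)
    (h : ∀ R ∈ hermitianBorderKernel d μ, (entryPairing T R).re = 0)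
    {M : Matrix (Border μ × Fin d) (Border μ × Fin d) ℂ} (hM : M ∈ borderKernel d μ) :
    entryPairing T M = 0 := by
  have hre : ∀ M ∈ borderKernel d μ, (entryPairing T M).re = 0 := by
    intro M hM
    have hadj : entryPairing T Mᴴ = star (entryPairing T M) := by
      simp only [entryPairing, star_sum, star_mul']
      rw [Finset.sum_comm]
      simp only [Matrix.conjTranspose_apply, hT.apply]
    have := h (M + Mᴴ) ⟨(borderKernel d μ).add_mem hM (conjTranspose_mem_borderKernel hM),
      Matrix.isHermitian_add_transpose_self M⟩
    rw [entryPairing_add, hadj] at this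
    simp at this
    linarith
  have him := hre _ ((borderKernel d μ).smul_mem Complex.I hM)
  have hsmul : entryPairing T (Complex.I • M) = Complex.I * entryPairing T M := by
    simp [entryPairing, Finset.mul_sum, mul_left_comm]
  rw [hsmul] at him
  exact Complex.ext (hre M hM) (by simpa using him)

lemma entryPairing_single {J : Type*} [Fintype J] [DecidableEq J] (T : Matrix J J ℂ) (i j : J)
    (c : ℂ) : entryPairing T (Matrix.single i j c) = T i j * c := by
  rw [entryPairing, Finset.sum_eq_single i, Finset.sum_eq_single j]
  · simp
  · intro b _ hb
    simp [hb.symm]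
  · simp
  · intro b _ hb
    simp [hb.symm]
  · simp

/-- A positive semidefinite representation in the border vector, modulo pencils. -/
lemma exists_posSemidef_borderCoeff {p : NCPoly d d μ} (hherm : polyStar p = p)
    (hpx : IsConvexInX p) (hpy : IsConvexInY p) :
    ∃ G : Matrix (Border μ × Fin d) (Border μ × Fin d) ℂ, G.PosSemidef ∧
      ∀ w, ¬ (xCount w ≤ 1 ∧ yCount w ≤ 1) → borderCoeff w G = p (FreeMonoid.ofList w) := by
  have hsupp := hasBorderSupport hherm hpx hpy
  set G₀ : Matrix (Border μ × Fin d) (Border μ × Fin d) ℂ := Matrix.of fun a b =>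
    borderWeight a.1 b.1 * p (FreeMonoid.ofList (borderProd a.1 b.1)) a.2 b.2 with hG₀
  have hG₀h : G₀.IsHermitian := by
    ext ⟨α, s⟩ ⟨β, t⟩
    rw [Matrix.conjTranspose_apply, hG₀, Matrix.of_apply, Matrix.of_apply, star_mul',
      star_borderWeight, borderWeight_comm]
    dsimp only
    conv_rhs => rw [← hherm, polyStar_apply, FreeMonoid.toList_ofList, borderProd_reverse]
    rfl
  obtain ⟨R, hR, hpsd⟩ := exists_add_posSemidef (hermitianBorderKernel d μ)
    (fun R hR => hR.2) (fun R hR => hR.1.1) hG₀h (fun T hT hTR => by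
      have horth := fun M (hM : M ∈ borderKernel d μ) =>
        entryPairing_eq_zero_of_mem_borderKernel hT.isHermitian hTR hM
      have heq : ∀ α β α' β' : Border μ, ∀ s t : Fin d, α ≠ β → α' ≠ β' →
          borderProd α β = borderProd α' β' → T (α, s) (β, t) = T (α', s) (β', t) := by
        intro α β α' β' s t hne hne' hprod
        have hmem : Matrix.single (α, s) (β, t) (1 : ℂ) + -Matrix.single (α', s) (β', t) (1 : ℂ)
            ∈ borderKernel d μ := by
          refine ⟨?_, fun w _ => ?_⟩
          · rw [Matrix.trace_add, Matrix.trace_neg, Matrix.trace_single_eq_of_ne,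
              Matrix.trace_single_eq_of_ne] <;> simp [hne, hne']
          · rw [map_add, map_neg, borderCoeff_single, borderCoeff_single, hprod, add_neg_cancel]
        have := horth _ hmem
        rw [entryPairing_add, ← neg_one_smul ℂ (Matrix.single (α', s) _ _), Matrix.smul_single,
          entryPairing_single, entryPairing_single] at this
        simpa [← sub_eq_add_neg, sub_eq_zero] using this
      have h := border_nonneg_of_posDef hpx hpy hsupp hT
        (fun i j s t => by
          have hmem : Matrix.single (Sum.inl (Sum.inl i), s) (Sum.inl (Sum.inr j), t) (1 : ℂ)
              ∈ borderKernel d μ := by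
            refine ⟨Matrix.trace_single_eq_of_ne _ _ _ (by simp), fun w hw => ?_⟩
            rw [borderCoeff_single, if_neg]
            rintro rfl
            exact hw (by simp [borderProd, borderWord])
          simpa [entryPairing_single] using horth _ hmem)
        (fun k i j s t => heq _ _ _ _ _ _ (by simp) (by simp) rfl)
        (fun k i j s t => heq _ _ _ _ _ _ (by simp) (by simp) rfl)
      have hpair : entryPairing T G₀ = ∑ α, ∑ β, borderWeight α β * ∑ s, ∑ t,
          p (FreeMonoid.ofList (borderProd α β)) s t * T (α, s) (β, t) := by
        simp only [entryPairing, Fintype.sum_prod_type, hG₀, Matrix.of_apply, Finset.mul_sum]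
        refine Finset.sum_congr rfl fun α _ => ?_
        rw [Finset.sum_comm]
        refine Finset.sum_congr rfl fun β _ => Finset.sum_congr rfl fun s _ =>
          Finset.sum_congr rfl fun t _ => ?_
        ring
      rw [hpair]
      exact (Complex.nonneg_iff.1 h).1)
  refine ⟨G₀ + R, hpsd, fun w hw => ?_⟩
  rw [map_add, hR.1.2 w hw, add_zero]
  ext s t
  have hcoeff : borderCoeff w G₀ s t =
      (∑ α, ∑ β, if borderProd α β = w then borderWeight α β else 0) *
        p (FreeMonoid.ofList w) s t := by
    rw [borderCoeff_apply]
    simp only [Finset.sum_mul, ite_mul, zero_mul]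
    refine Finset.sum_congr rfl fun α _ => Finset.sum_congr rfl fun β _ => ?_
    split_ifs with h
    · rw [hG₀, Matrix.of_apply, h]
    · rfl
  rw [hcoeff]
  by_cases hpw : p (FreeMonoid.ofList w) = 0
  · simp [hpw]
  · obtain ⟨α, β, rfl⟩ := (hsupp w hpw).resolve_left hw
    rw [sum_borderWeight_fiber α β hw, one_mul]

lemma polyMul_sum_single {a b c : ℕ} {ι κ : Type*} (s : Finset ι) (t : Finset κ)
    (u : ι → FreeWord μ) (A : ι → Matrix (Fin a) (Fin b) ℂ) (v : κ → FreeWord μ)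
    (B : κ → Matrix (Fin b) (Fin c) ℂ) :
    polyMul (∑ i ∈ s, Finsupp.single (u i) (A i)) (∑ j ∈ t, Finsupp.single (v j) (B j)) =
      ∑ i ∈ s, ∑ j ∈ t, Finsupp.single (u i * v j) (A i * B j) := by
  unfold polyMul
  refine (Finsupp.sum_finsetSum_index (fun u => ?_) fun u A A' => ?_).symm.trans
    (Finset.sum_congr rfl fun i _ => (Finsupp.sum_single_index ?_).trans
      ((Finsupp.sum_finsetSum_index (fun v => ?_) fun v B B' => ?_).symm.trans
        (Finset.sum_congr rfl fun j _ => Finsupp.sum_single_index ?_)))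
  · simp
  · simp [Matrix.add_mul, Finsupp.single_add, Finsupp.sum_add]
  · simp
  · simp
  · simp [Matrix.mul_add, Finsupp.single_add]
  · simp

lemma polyStar_sum {N : ℕ} {ι : Type*} (s : Finset ι) (f : ι → NCPoly N d μ) :
    polyStar (∑ i ∈ s, f i) = ∑ i ∈ s, polyStar (f i) := by
  ext w : 1
  simp [polyStar_apply, Finsupp.finsetSum_apply, Matrix.conjTranspose_sum]

/-- A positive semidefinite representation yields a square of a pencil. -/
lemma exists_pencil_square (hd : 0 < d) (hμ : 0 < μ)
    {G : Matrix (Border μ × Fin d) (Border μ × Fin d) ℂ} (hG : G.PosSemidef) :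
    ∃ N : ℕ, 0 < N ∧ ∃ Λ : NCPoly N d μ, IsXYPencil Λ ∧
      ∀ w, polyMul (polyStar Λ) Λ (FreeMonoid.ofList w) = borderCoeff w G := by
  obtain ⟨M, rfl⟩ := hG.exists_eq_conjTranspose_mul_self
  have : Nonempty (Border μ × Fin d) := ⟨(Sum.inl (Sum.inl ⟨0, hμ⟩), ⟨0, hd⟩)⟩
  let e := Fintype.equivFin (Border μ × Fin d)
  let B : Border μ → Matrix (Fin (Fintype.card (Border μ × Fin d))) (Fin d) ℂ := fun β =>
    Matrix.of fun n t => M (e.symm n) (β, t)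
  have hB : ∀ α β s t, ((B α)ᴴ * B β) s t = (Mᴴ * M) (α, s) (β, t) := by
    intro α β s t
    simp only [Matrix.mul_apply, Matrix.conjTranspose_apply, B, Matrix.of_apply]
    exact e.symm.sum_comp fun a => star (M a (α, s)) * M a (β, t)
  refine ⟨_, Fintype.card_pos, ∑ β, Finsupp.single (FreeMonoid.ofList (borderWord β)) (B β),
    fun w hw => ?_, fun w => ?_⟩
  · rw [Finsupp.finsetSum_apply] at hw
    obtain ⟨β, -, hβ⟩ := Finset.exists_ne_zero_of_sum_ne_zero hw
    have : FreeMonoid.ofList (borderWord β) = w := by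
      by_contra hne
      exact hβ (Finsupp.single_eq_of_ne' hne)
    subst this
    change xCount (borderWord β) ≤ 1 ∧ yCount (borderWord β) ≤ 1
    rcases β with (i | i) | ⟨i, k⟩ | ⟨i, k⟩ <;> simp [borderWord]
  · rw [polyStar_sum]
    simp only [polyStar_single, FreeMonoid.toList_ofList]
    rw [polyMul_sum_single]
    ext s t
    simp only [Finsupp.finsetSum_apply, borderCoeff_apply, Matrix.sum_apply, ← hB]
    refine Finset.sum_congr rfl fun α _ => Finset.sum_congr rfl fun β _ => ?_
    rw [← FreeMonoid.ofList_append, ← borderProd]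
    by_cases h : borderProd α β = w
    · rw [h, if_pos rfl, Finsupp.single_eq_same]
    · rw [if_neg h, Finsupp.single_eq_of_ne' fun h' => h (FreeMonoid.ofList.injective h'),
        Matrix.zero_apply]

lemma exists_pencil_add_square (hd : 0 < d) (hμ : 0 < μ) {p : NCPoly d d μ}
    (hherm : polyStar p = p) (hpx : IsConvexInX p) (hpy : IsConvexInY p) :
    ∃ lam : NCPoly d d μ, polyStar lam = lam ∧ IsXYPencil lam ∧
      ∃ N : ℕ, 0 < N ∧ ∃ Λ : NCPoly N d μ, IsXYPencil Λ ∧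
        p = lam + polyMul (polyStar Λ) Λ := by
  obtain ⟨G, hG, hGp⟩ := exists_posSemidef_borderCoeff hherm hpx hpy
  obtain ⟨N, hN, Λ, hΛ, hΛG⟩ := exists_pencil_square hd hμ hG
  refine ⟨p - polyMul (polyStar Λ) Λ, ?_, ?_, N, hN, Λ, hΛ, by simp⟩
  · have hstar : polyStar (polyMul (polyStar Λ) Λ) = polyMul (polyStar Λ) Λ := by
      ext w : 1
      rw [polyStar_apply, hΛG, ← borderCoeff_conjTranspose, hG.isHermitian.eq, ← hΛG,
        FreeMonoid.ofList_toList]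
    rw [polyStar_sub, hherm, hstar]
  · intro w hw
    by_contra hpen
    refine hw ?_
    have := hΛG w.toList
    rw [hGp w.toList hpen, FreeMonoid.ofList_toList] at this
    rw [Finsupp.sub_apply, this, sub_self]

end Certificate

/-- For a hermitian `d × d` matrix-valued free polynomial `p(x,y)`,
the following are equivalent: (i) `p` is `xy`-convex; (ii) `p` is convex in `x` and in `y`
separately; (iii) `p = λ + Λ* Λ` with `λ` a hermitian `d × d` `xy`-pencil and `Λ` an
`N × d` `xy`-pencil. -/
theorem xyConvex_tfae {d μ : ℕ} (hd : 0 < d) (hμ : 0 < μ)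
    (p : NCPoly d d μ) (hherm : polyStar p = p) :
    (IsXYConvex p ↔ (IsConvexInX p ∧ IsConvexInY p)) ∧
    (IsXYConvex p ↔
      ∃ lam : NCPoly d d μ, polyStar lam = lam ∧ IsXYPencil lam ∧
        ∃ N : ℕ, 0 < N ∧ ∃ Λ : NCPoly N d μ, IsXYPencil Λ ∧
          p = lam + polyMul (polyStar Λ) Λ) := by
  have hcert : IsConvexInX p ∧ IsConvexInY p →
      ∃ lam : NCPoly d d μ, polyStar lam = lam ∧ IsXYPencil lam ∧
        ∃ N : ℕ, 0 < N ∧ ∃ Λ : NCPoly N d μ, IsXYPencil Λ ∧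
          p = lam + polyMul (polyStar Λ) Λ :=
    fun h => exists_pencil_add_square hd hμ hherm h.1 h.2
  have hconv : (∃ lam : NCPoly d d μ, polyStar lam = lam ∧ IsXYPencil lam ∧
      ∃ N : ℕ, 0 < N ∧ ∃ Λ : NCPoly N d μ, IsXYPencil Λ ∧
        p = lam + polyMul (polyStar Λ) Λ) → IsXYConvex p := by
    rintro ⟨lam, -, hlam, N, -, Λ, hΛ, rfl⟩
    exact isXYConvex_of_pencil hlam hΛ
  have hsep : IsXYConvex p → IsConvexInX p ∧ IsConvexInY p :=
    fun h => ⟨h.isConvexInX, h.isConvexInY⟩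
  exact ⟨⟨hsep, hconv ∘ hcert⟩, ⟨hcert ∘ hsep, hconv⟩⟩
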